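/- arXiv:1602.02654 — 5 statements merged into one kernel-verified Lean document; each statement's English description precedes it below -/
import Mathlib

section
/- Let Γ be a countable group acting non-singularly on a standard probability space (X,μ), and let Ω ⊆ Γ be a subset invariant under conjugation. Suppose that for each n ∈ ℕ we are given measurable functions h_nᵗ : X → [0,∞) indexed by t ∈ Γ such that sup_n ‖Σ_{t∈Γ} h_nᵗ‖_∞ < ∞, and such that for every s ∈ Γ, Σ_{t∈Γ} ‖h_nᵗ − s·h_n^{s⁻¹ts}‖_{L¹(μ)} → 0 as n → ∞, where (s·f)(x) := f(s⁻¹x). If limsup_n ∫_X Σ_{t∈Ω} h_nᵗ dμ > 0, then there exists a Γ-invariant measurable subset X₀ ⊆ X with μ(X₀) > 0 such that the restricted action Γ ↷ (X₀, μ|_{X₀}) admits a Γ-equivariant conditional expectation from L∞(Ω × X₀) onto L∞(X₀), where Γ acts on Ω by conjugation. -/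
open MeasureTheory Filter Topology Pointwise
open scoped symmDiff ENNReal

lemma MeasureTheory.ae_forall_of_ae_count_prod {X ι : Type*} [MeasurableSpace X]
    [MeasurableSpace ι] [Countable ι] {μ : Measure X} [SFinite μ] {p : ι × X → Prop}
    (hp : ∀ᵐ z ∂(Measure.count : Measure ι).prod μ, p z) : ∀ᵐ x ∂μ, ∀ t, p (t, x) :=
  ae_all_iff.2 (Measure.ae_count_iff.1 (Measure.ae_ae_of_ae_prod hp))

lemma MeasureTheory.Lp.measurable_section {X ι : Type*} [MeasurableSpace X] [MeasurableSpace ι]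
    {μ : Measure X} (F : Lp ℝ ⊤ ((Measure.count : Measure ι).prod μ)) (t : ι) :
    Measurable fun x => F (t, x) :=
  (Lp.stronglyMeasurable F).measurable.comp measurable_prodMk_left

lemma MeasureTheory.Lp.ae_abs_le_norm {X : Type*} [MeasurableSpace X] {μ : Measure X}
    (F : Lp ℝ ⊤ μ) : ∀ᵐ x ∂μ, |F x| ≤ ‖F‖ := by
  filter_upwards [ae_le_eLpNormEssSup (f := F) (μ := μ)] with x hx
  rw [Lp.norm_def, ← Real.norm_eq_abs, ← toReal_enorm]
  exact ENNReal.toReal_mono (Lp.eLpNorm_ne_top F) (by rwa [eLpNorm_exponent_top])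

lemma MeasureTheory.Lp.ae_abs_section_le {X ι : Type*} [MeasurableSpace X] [MeasurableSpace ι]
    [Countable ι] {μ : Measure X} [SFinite μ] (F : Lp ℝ ⊤ ((Measure.count : Measure ι).prod μ)) :
    ∀ᵐ x ∂μ, ∀ t, |F (t, x)| ≤ ‖F‖ :=
  ae_forall_of_ae_count_prod (Lp.ae_abs_le_norm F)

/-- Weak-star convergence in `L∞(μ)`, i.e. convergence tested against integrable functions. -/
def TendstoWeakStar {X ι : Type*} [MeasurableSpace X] (μ : Measure X) (l : Filter ι)
    (k : ι → X → ℝ) (f : X → ℝ) : Prop :=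
  ∀ g : X → ℝ, Integrable g μ →
    Tendsto (fun n => ∫ x, k n x * g x ∂μ) l (𝓝 (∫ x, f x * g x ∂μ))

namespace TendstoWeakStar

variable {X ι : Type*} [MeasurableSpace X] {μ : Measure X} {l : Filter ι}
  {k k' : ι → X → ℝ} {f f' : X → ℝ}

lemma _root_.MeasureTheory.MemLp.integrable_mul_of_top {f g : X → ℝ} (hf : MemLp f ⊤ μ)
    (hg : Integrable g μ) : Integrable (fun x => f x * g x) μ :=
  (memLp_one_iff_integrable.2 hg).integrable_mul hf |>.congr
    (Eventually.of_forall fun x => by simp [mul_comm])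

lemma congr (hk : TendstoWeakStar μ l k f) (h : ∀ n, k n =ᵐ[μ] k' n) (hf : f =ᵐ[μ] f') :
    TendstoWeakStar μ l k' f' := by
  intro g hg
  have h1 : ∫ x, f' x * g x ∂μ = ∫ x, f x * g x ∂μ :=
    integral_congr_ae (by filter_upwards [hf] with x hx; rw [hx])
  rw [h1]
  refine (hk g hg).congr fun n => integral_congr_ae ?_
  filter_upwards [h n] with x hx
  rw [hx]

lemma const_mul (hk : TendstoWeakStar μ l k f) (c : ℝ) :
    TendstoWeakStar μ l (fun n x => c * k n x) (fun x => c * f x) := by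
  intro g hg
  simpa only [mul_assoc, integral_const_mul] using (hk g hg).const_mul c

lemma add (hk : TendstoWeakStar μ l k f) (hk' : TendstoWeakStar μ l k' f')
    (hm : ∀ n, MemLp (k n) ⊤ μ) (hm' : ∀ n, MemLp (k' n) ⊤ μ)
    (hf : MemLp f ⊤ μ) (hf' : MemLp f' ⊤ μ) :
    TendstoWeakStar μ l (fun n x => k n x + k' n x) (fun x => f x + f' x) := by
  intro g hg
  simp only [add_mul]
  rw [integral_add (hf.integrable_mul_of_top hg) (hf'.integrable_mul_of_top hg)]
  refine ((hk g hg).add (hk' g hg)).congr fun n => ?_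
  rw [integral_add ((hm n).integrable_mul_of_top hg) ((hm' n).integrable_mul_of_top hg)]

lemma mul_right (hk : TendstoWeakStar μ l k f) {b : X → ℝ} (hb : MemLp b ⊤ μ) :
    TendstoWeakStar μ l (fun n x => k n x * b x) (fun x => f x * b x) := by
  intro g hg
  simpa only [mul_assoc] using hk _ (hb.integrable_mul_of_top hg)

lemma restrict (hk : TendstoWeakStar μ l k f) {s : Set X} (hs : MeasurableSet s) :
    TendstoWeakStar (μ.restrict s) l k f := by
  intro g hg
  have key : ∀ u : X → ℝ, ∫ x in s, u x * g x ∂μ = ∫ x, u x * s.indicator g x ∂μ := by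
    intro u
    rw [← integral_indicator hs]
    congr 1
    ext x
    by_cases hx : x ∈ s <;> simp [hx]
  simpa only [key] using hk _ ((integrable_indicator_iff hs).2 hg)

lemma tendsto_setIntegral [IsFiniteMeasure μ] (hk : TendstoWeakStar μ l k f) {s : Set X}
    (hs : MeasurableSet s) :
    Tendsto (fun n => ∫ x in s, k n x ∂μ) l (𝓝 (∫ x in s, f x ∂μ)) := by
  simpa using hk.restrict hs (fun _ => 1) (integrable_const 1)

variable [IsFiniteMeasure μ]

lemma ae_nonneg [l.NeBot] (hk : TendstoWeakStar μ l k f) (hf : MemLp f ⊤ μ)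
    (h : ∀ n, 0 ≤ᵐ[μ] k n) : 0 ≤ᵐ[μ] f := by
  refine ae_nonneg_of_forall_setIntegral_nonneg (hf.integrable le_top) fun s hs _ => ?_
  exact ge_of_tendsto' (hk.tendsto_setIntegral hs) fun n =>
    integral_nonneg_of_ae (ae_restrict_of_ae (h n))

lemma ae_unique [l.NeBot] (hk : TendstoWeakStar μ l k f) (hk' : TendstoWeakStar μ l k f')
    (hf : MemLp f ⊤ μ) (hf' : MemLp f' ⊤ μ) : f =ᵐ[μ] f' :=
  Integrable.ae_eq_of_forall_setIntegral_eq _ _ (hf.integrable le_top) (hf'.integrable le_top)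
    fun _ hs _ => tendsto_nhds_unique (hk.tendsto_setIntegral hs) (hk'.tendsto_setIntegral hs)

/-- Composition with a nonsingular automorphism is weak-star continuous. -/
lemma comp_quasiMeasurePreserving (hk : TendstoWeakStar μ l k f) {T S : X → X}
    (hT : Measure.QuasiMeasurePreserving T μ μ) (hS : Measure.QuasiMeasurePreserving S μ μ)
    (hST : ∀ x, S (T x) = x) (hkm : ∀ n, Measurable (k n)) (hfm : Measurable f) :
    TendstoWeakStar μ l (fun n x => k n (T x)) (fun x => f (T x)) := by
  intro g hg
  have hgS : AEStronglyMeasurable (fun x => g (S x)) (μ.map T) :=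
    (hg.aestronglyMeasurable.comp_quasiMeasurePreserving hS).mono_ac hT.absolutelyContinuous
  have hgi : Integrable (fun x => g (S x)) (μ.map T) := by
    rw [integrable_map_measure hgS hT.measurable.aemeasurable]
    simpa [Function.comp_def, hST] using hg
  have key : ∀ u : X → ℝ, Measurable u → ∫ x, u (T x) * g x ∂μ =
      ∫ x, u x * (((μ.map T).rnDeriv μ x).toReal • g (S x)) ∂μ := by
    intro u hu
    have h1 : ∫ x, u (T x) * g x ∂μ = ∫ y, u y * g (S y) ∂(μ.map T) := by
      rw [integral_map (f := fun y => u y * g (S y)) hT.measurable.aemeasurable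
        (hu.aestronglyMeasurable.mul hgS)]
      simp [hST]
    rw [h1, ← integral_rnDeriv_smul hT.absolutelyContinuous]
    congr 1
    ext x
    simp only [smul_eq_mul]
    ring
  simp only [key _ (hkm _), key _ hfm]
  exact hk _ ((integrable_rnDeriv_smul_iff hT.absolutelyContinuous).2 hgi)

lemma ae_eq_of_tendsto_lintegral [l.NeBot] (hk : TendstoWeakStar μ l k f)
    (hk' : TendstoWeakStar μ l k' f')
    (hm : ∀ n, MemLp (k n) ⊤ μ) (hm' : ∀ n, MemLp (k' n) ⊤ μ)
    (hf : MemLp f ⊤ μ) (hf' : MemLp f' ⊤ μ)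
    (h : Tendsto (fun n => ∫⁻ x, ‖k n x - k' n x‖ₑ ∂μ) l (𝓝 0)) : f =ᵐ[μ] f' := by
  refine Integrable.ae_eq_of_forall_setIntegral_eq _ _ (hf.integrable le_top)
    (hf'.integrable le_top) fun s hs _ => ?_
  have h0 : Tendsto (fun n => ∫ x in s, k n x ∂μ - ∫ x in s, k' n x ∂μ) l (𝓝 0) := by
    rw [tendsto_zero_iff_enorm_tendsto_zero]
    refine tendsto_of_tendsto_of_tendsto_of_le_of_le tendsto_const_nhds h
      (fun _ => zero_le) fun n => ?_
    dsimp only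
    rw [← integral_sub ((hm n).integrable le_top).integrableOn
      ((hm' n).integrable le_top).integrableOn]
    exact (enorm_integral_le_lintegral_enorm _).trans (setLIntegral_le_lintegral _ _)
  exact sub_eq_zero.1 (tendsto_nhds_unique
    ((hk.tendsto_setIntegral hs).sub (hk'.tendsto_setIntegral hs)) h0)

lemma ae_abs_le_of_forall_setIntegral_le {f : X → ℝ} (hf : Integrable f μ) {M : ℝ}
    (h : ∀ s, MeasurableSet s → |∫ x in s, f x ∂μ| ≤ M * μ.real s) : ∀ᵐ x ∂μ, |f x| ≤ M := by
  have h1 : f ≤ᵐ[μ] fun _ => M := by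
    refine ae_le_of_forall_setIntegral_le hf (integrable_const _) fun s hs _ => ?_
    simpa [mul_comm] using (abs_le.1 (h s hs)).2
  have h2 : (fun _ => -M) ≤ᵐ[μ] f := by
    refine ae_le_of_forall_setIntegral_le (integrable_const _) hf fun s hs _ => ?_
    simpa [mul_comm] using (abs_le.1 (h s hs)).1
  filter_upwards [h1, h2] with x hx hy using abs_le.2 ⟨hy, hx⟩

/-- Every bounded functional on `L¹` of a finite measure is represented by a bounded function. -/
lemma exists_integral_eq_dual_apply (a : StrongDual ℝ (Lp ℝ 1 μ)) :
    ∃ f : X → ℝ, Measurable f ∧ MemLp f ⊤ μ ∧ (∀ᵐ x ∂μ, |f x| ≤ ‖a‖) ∧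
      ∀ g : Lp ℝ 1 μ, a g = ∫ x, f x * g x ∂μ := by
  let one₂ : Lp ℝ 2 μ := Lp.const 2 μ 1
  let J : Lp ℝ 2 μ →L[ℝ] Lp ℝ 1 μ := (ContinuousLinearMap.mul ℝ ℝ).holderL μ 2 2 1 one₂
  let w : Lp ℝ 2 μ := (InnerProductSpace.toDual ℝ (Lp ℝ 2 μ)).symm (a.comp J)
  have hJ : ∀ (s : Set X) (hs : MeasurableSet s) (c : ℝ),
      J (indicatorConstLp 2 hs (measure_ne_top μ s) c) =
        indicatorConstLp 1 hs (measure_ne_top μ s) c := by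
    intro s hs c
    apply Lp.ext
    refine ((ContinuousLinearMap.mul ℝ ℝ).coeFn_holder one₂ _).trans ?_
    filter_upwards [Lp.coeFn_const 2 μ (1 : ℝ),
      indicatorConstLp_coeFn (p := 1) (hs := hs) (hμs := measure_ne_top μ s) (c := c),
      indicatorConstLp_coeFn (p := 2) (hs := hs) (hμs := measure_ne_top μ s) (c := c)]
      with x h1 h2 h3
    rw [h2, h3, show one₂ x = 1 from h1]
    simp
  have hset : ∀ (s : Set X) (hs : MeasurableSet s) (c : ℝ),
      a (indicatorConstLp 1 hs (measure_ne_top μ s) c) = c * ∫ x in s, w x ∂μ := by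
    intro s hs c
    rw [← hJ s hs]
    have := L2.inner_indicatorConstLp_eq_inner_setIntegral ℝ hs (measure_ne_top μ s) c w
    rw [real_inner_comm, InnerProductSpace.toDual_symm_apply] at this
    simpa [mul_comm] using this
  have hwm : Measurable w := (Lp.stronglyMeasurable w).measurable
  have hwi : Integrable w μ := (Lp.memLp w).integrable (by norm_num)
  have hwb : ∀ᵐ x ∂μ, |w x| ≤ ‖a‖ := by
    refine ae_abs_le_of_forall_setIntegral_le hwi fun s hs => ?_
    have h1 := a.le_opNorm (indicatorConstLp 1 hs (measure_ne_top μ s) 1)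
    rw [hset s hs, norm_indicatorConstLp (by norm_num) (by norm_num)] at h1
    simpa using h1
  have hwt : MemLp w ⊤ μ := memLp_top_of_bound hwm.aestronglyMeasurable _ hwb
  refine ⟨w, hwm, hwt, hwb, fun g => ?_⟩
  let P := (ContinuousLinearMap.mul ℝ ℝ).lpPairing μ ⊤ 1 hwt.toLp
  have hP : ∀ g : Lp ℝ 1 μ, P g = ∫ x, w x * g x ∂μ := by
    intro g
    rw [ContinuousLinearMap.lpPairing_eq_integral]
    refine integral_congr_ae ?_
    filter_upwards [hwt.coeFn_toLp] with x hx
    simp [hx]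
  rw [← hP]
  refine Lp.induction ENNReal.one_ne_top (fun g => a g = P g) (fun c s hs hμs => ?_)
    (fun f g hf hg _ h1 h2 => by rw [map_add, map_add, h1, h2])
    (isClosed_eq a.continuous P.continuous) g
  rw [Lp.simpleFunc.coe_indicatorConst, hset s hs, hP, ← integral_const_mul,
    ← integral_indicator hs]
  refine integral_congr_ae ?_
  filter_upwards [indicatorConstLp_coeFn (p := 1) (hs := hs) (hμs := hμs.ne) (c := c)] with x hx
  rw [hx]
  by_cases h : x ∈ s <;> simp [h, mul_comm]

/-- Bounded sequences in `L∞` converge weak-star along ultrafilters. -/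
lemma exists_of_ultrafilter (U : Ultrafilter ι) {M : ℝ}
    (hkm : ∀ n, AEStronglyMeasurable (k n) μ) (hk : ∀ n, ∀ᵐ x ∂μ, |k n x| ≤ M) :
    ∃ f : X → ℝ, Measurable f ∧ MemLp f ⊤ μ ∧ TendstoWeakStar μ U k f := by
  have hkt : ∀ n, MemLp (k n) ⊤ μ := fun n => memLp_top_of_bound (hkm n) M (hk n)
  let B := (ContinuousLinearMap.mul ℝ ℝ).lpPairing μ ⊤ 1
  have hB : ∀ n (g : Lp ℝ 1 μ), B (hkt n).toLp g = ∫ x, k n x * g x ∂μ := by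
    intro n g
    rw [ContinuousLinearMap.lpPairing_eq_integral]
    refine integral_congr_ae ?_
    filter_upwards [(hkt n).coeFn_toLp] with x hx
    simp [hx]
  let v : ι → WeakDual ℝ (Lp ℝ 1 μ) := fun n => StrongDual.toWeakDual (B (hkt n).toLp)
  have hv : ∀ n, v n ∈ WeakDual.toStrongDual ⁻¹'
      Metric.closedBall (0 : StrongDual ℝ (Lp ℝ 1 μ)) (‖B‖ * |M|) := by
    intro n
    simp only [Set.mem_preimage, mem_closedBall_zero_iff]
    refine (B.le_opNorm _).trans (mul_le_mul_of_nonneg_left ?_ (norm_nonneg _))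
    have := Lp.norm_le_of_ae_bound (f := (hkt n).toLp) (abs_nonneg M) (by
      filter_upwards [(hkt n).coeFn_toLp, hk n] with x hx h
      rw [hx]
      exact h.trans (le_abs_self M))
    simpa using this
  obtain ⟨a, -, ha⟩ := (WeakDual.isCompact_closedBall _ _).ultrafilter_le_nhds (U.map v)
    (by
      simp only [Ultrafilter.coe_map, le_principal_iff, mem_map]
      exact Eventually.of_forall hv)
  obtain ⟨f, hfm, hft, -, hf⟩ := exists_integral_eq_dual_apply (WeakDual.toStrongDual a)
  refine ⟨f, hfm, hft, fun g hg => ?_⟩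
  have hlim : Tendsto (fun n => v n (hg.toL1 g)) U (𝓝 (a (hg.toL1 g))) :=
    ((WeakDual.eval_continuous _).tendsto a).comp ha
  have hcongr : ∀ u : X → ℝ, ∫ x, u x * hg.toL1 g x ∂μ = ∫ x, u x * g x ∂μ := by
    intro u
    refine integral_congr_ae ?_
    filter_upwards [hg.coeFn_toL1] with x hx
    rw [hx]
  rw [← hcongr f, ← hf]
  refine hlim.congr fun n => ?_
  rw [← hcongr]
  exact hB n _

end TendstoWeakStar

lemma TendstoWeakStar.density_unique {X ι : Type*} [MeasurableSpace X] {μ : Measure X}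
    [IsFiniteMeasure μ] {l : Filter ι} [l.NeBot] {k : ι → X → ℝ} {f : X → ℝ} (hft : MemLp f ⊤ μ)
    (hpos : ∀ᵐ x ∂μ, 0 < f x) {φ ψ : Lp ℝ ⊤ μ}
    (hφ : TendstoWeakStar μ l k fun x => f x * φ x)
    (hψ : TendstoWeakStar μ l k fun x => f x * ψ x) : φ = ψ := by
  apply Lp.ext
  filter_upwards [hφ.ae_unique hψ ((Lp.memLp φ).mul hft) ((Lp.memLp ψ).mul hft), hpos]
    with x hx h0
  exact mul_left_cancel₀ h0.ne' hx

/-- A sequence of uniformly bounded families of nonnegative weights, indexed by `ι`, on a measure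
space. -/
structure IsBoundedWeight {X ι : Type*} [MeasurableSpace X] (μ : Measure X)
    (h : ℕ → ι → X → ℝ) (C : ℝ) : Prop where
  measurable : ∀ n t, Measurable (h n t)
  nonneg : ∀ n t x, 0 ≤ h n t x
  summable : ∀ n x, Summable fun t => h n t x
  tsum_le : ∀ n, ∀ᵐ x ∂μ, ∑' t, h n t x ≤ C

namespace IsBoundedWeight

lemma _root_.Summable.mul_of_abs_le {ι : Type*} {a b : ι → ℝ} {B : ℝ} (ha : Summable a)
    (h0 : ∀ i, 0 ≤ a i) (hb : ∀ i, |b i| ≤ B) : Summable fun i => a i * b i := by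
  refine Summable.of_norm_bounded (ha.mul_right B) fun i => ?_
  rw [norm_mul, Real.norm_of_nonneg (h0 i)]
  exact mul_le_mul_of_nonneg_left (hb i) (h0 i)

lemma _root_.Summable.abs_tsum_mul_le {ι : Type*} {a b : ι → ℝ} {B : ℝ} (ha : Summable a)
    (h0 : ∀ i, 0 ≤ a i) (hb : ∀ i, |b i| ≤ B) : |∑' i, a i * b i| ≤ (∑' i, a i) * B := by
  rw [← tsum_mul_right]
  refine tsum_of_norm_bounded (f := fun i => a i * b i) (ha.mul_right B).hasSum fun i => ?_
  rw [norm_mul, Real.norm_of_nonneg (h0 i)]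
  exact mul_le_mul_of_nonneg_left (hb i) (h0 i)

lemma _root_.MeasureTheory.MemLp.comp_of_top {X : Type*} [MeasurableSpace X] {μ : Measure X}
    {f : X → ℝ} {T : X → X} (hf : MemLp f ⊤ μ) (hT : Measure.QuasiMeasurePreserving T μ μ) :
    MemLp (fun x => f (T x)) ⊤ μ := by
  refine ⟨hf.1.comp_quasiMeasurePreserving hT, lt_of_le_of_lt ?_ hf.2⟩
  simp only [eLpNorm_exponent_top]
  exact essSup_le_of_ae_le _ (hT.ae ae_le_eLpNormEssSup)

variable {X ι : Type*} [MeasurableSpace X] {μ : Measure X}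
  {h : ℕ → ι → X → ℝ} {C : ℝ} {F G : ι → X → ℝ} {B : ℝ} {U : Ultrafilter ℕ} {f : X → ℝ}

lemma restrict (hw : IsBoundedWeight μ h C) (s : Set X) :
    IsBoundedWeight (μ.restrict s) h C :=
  ⟨hw.measurable, hw.nonneg, hw.summable, fun n => ae_restrict_of_ae (hw.tsum_le n)⟩

lemma abs_tsum_mul_le (hw : IsBoundedWeight μ h C)
    (hB : ∀ᵐ x ∂μ, ∀ t, |F t x| ≤ B) (n : ℕ) :
    ∀ᵐ x ∂μ, |∑' t, h n t x * F t x| ≤ C * |B| := by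
  filter_upwards [hB, hw.tsum_le n] with x hx hC
  refine ((hw.summable n x).abs_tsum_mul_le (fun t => hw.nonneg n t x)
    fun t => (hx t).trans (le_abs_self B)).trans ?_
  exact mul_le_mul_of_nonneg_right hC (abs_nonneg B)

variable [Countable ι]

lemma measurable_tsum_mul (hw : IsBoundedWeight μ h C) (hF : ∀ t, Measurable (F t)) (n : ℕ) :
    Measurable fun x => ∑' t, h n t x * F t x :=
  Measurable.tsum fun t => (hw.measurable n t).mul (hF t)

lemma memLp_tsum_mul (hw : IsBoundedWeight μ h C) (hF : ∀ t, Measurable (F t))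
    (hB : ∀ᵐ x ∂μ, ∀ t, |F t x| ≤ B) (n : ℕ) :
    MemLp (fun x => ∑' t, h n t x * F t x) ⊤ μ :=
  memLp_top_of_bound (hw.measurable_tsum_mul hF n).aestronglyMeasurable _
    (hw.abs_tsum_mul_le hB n)

variable [IsFiniteMeasure μ]

lemma exists_tendstoWeakStar (hw : IsBoundedWeight μ h C) (U : Ultrafilter ℕ)
    (hF : ∀ t, Measurable (F t)) (hB : ∀ᵐ x ∂μ, ∀ t, |F t x| ≤ B) :
    ∃ w : X → ℝ, Measurable w ∧ MemLp w ⊤ μ ∧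
      TendstoWeakStar μ U (fun n x => ∑' t, h n t x * F t x) w :=
  TendstoWeakStar.exists_of_ultrafilter U
    (fun n => (hw.measurable_tsum_mul hF n).aestronglyMeasurable) (hw.abs_tsum_mul_le hB)

/-- The weak-star limit of weighted sums against `F` has a bounded density with respect to the
limit of the total weights. -/
lemma exists_density (hw : IsBoundedWeight μ h C) (hfm : Measurable f) (hft : MemLp f ⊤ μ)
    (hpos : ∀ᵐ x ∂μ, 0 < f x) (hf : TendstoWeakStar μ U (fun n x => ∑' t, h n t x) f)
    (hF : ∀ t, Measurable (F t)) (hB : ∀ᵐ x ∂μ, ∀ t, |F t x| ≤ B) :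
    ∃ φ : Lp ℝ ⊤ μ, TendstoWeakStar μ U (fun n x => ∑' t, h n t x * F t x)
      (fun x => f x * φ x) := by
  obtain ⟨w, hwm, hwt, hlim⟩ := hw.exists_tendstoWeakStar U hF hB
  have hone : ∀ n, MemLp (fun x => ∑' t, h n t x) ⊤ μ := fun n => by
    simpa using hw.memLp_tsum_mul (F := fun _ _ => 1) (B := 1) (fun _ => measurable_const)
      (by simp) n
  have hsign : ∀ c : ℝ, |c| = 1 → ∀ᵐ x ∂μ, 0 ≤ B * f x + c * w x := by
    intro c hc
    have hadd := (hf.const_mul B).add (hlim.const_mul c) (fun n => (hone n).const_mul B)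
      (fun n => (hw.memLp_tsum_mul hF hB n).const_mul c) (hft.const_mul B) (hwt.const_mul c)
    refine hadd.ae_nonneg ((hft.const_mul B).add (hwt.const_mul c)) fun n => ?_
    filter_upwards [hB] with x hx
    have h1 := (hw.summable n x).abs_tsum_mul_le (fun t => hw.nonneg n t x) hx
    have h2 : |c * ∑' t, h n t x * F t x| ≤ (∑' t, h n t x) * B := by
      rwa [abs_mul, hc, one_mul]
    have h3 := (abs_le.1 h2).1
    simp only [Pi.zero_apply]
    linarith
  have hle : ∀ᵐ x ∂μ, |w x / f x| ≤ B := by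
    filter_upwards [hpos, hsign 1 (by simp), hsign (-1) (by simp)] with x h0 h1 h2
    rw [abs_div, abs_of_pos h0, div_le_iff₀ h0, abs_le]
    constructor <;> linarith
  have hφ : MemLp (fun x => w x / f x) ⊤ μ :=
    memLp_top_of_bound (hwm.div hfm).aestronglyMeasurable B hle
  refine ⟨hφ.toLp, hlim.congr (fun _ => EventuallyEq.rfl) ?_⟩
  filter_upwards [hφ.coeFn_toLp, hpos] with x hx h0
  rw [hx, mul_div_cancel₀ _ h0.ne']

/-- If the weights are asymptotically invariant under a nonsingular automorphism, weak-star limits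
of weighted sums are equivariant. -/
lemma ae_eq_comp (hw : IsBoundedWeight μ h C) (hU : (U : Filter ℕ) ≤ atTop) {T S : X → X}
    (hT : Measure.QuasiMeasurePreserving T μ μ) (hS : Measure.QuasiMeasurePreserving S μ μ)
    (hST : ∀ x, S (T x) = x) (e : ι ≃ ι)
    (happrox : Tendsto (fun n => ∑' t, ∫⁻ x, ‖h n t x - h n (e t) (T x)‖ₑ ∂μ) atTop (𝓝 0))
    (hF : ∀ t, Measurable (F t)) (hG : ∀ t, Measurable (G t))
    (hFB : ∀ᵐ x ∂μ, ∀ t, |F t x| ≤ B) (hFG : ∀ᵐ x ∂μ, ∀ t, G t x = F (e t) (T x))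
    {w v : X → ℝ} (hwm : Measurable w) (hwt : MemLp w ⊤ μ) (hvt : MemLp v ⊤ μ)
    (hFw : TendstoWeakStar μ U (fun n x => ∑' t, h n t x * F t x) w)
    (hGv : TendstoWeakStar μ U (fun n x => ∑' t, h n t x * G t x) v) :
    v =ᵐ[μ] fun x => w (T x) := by
  have hFT : ∀ᵐ x ∂μ, ∀ t, |F t (T x)| ≤ B := hT.ae hFB
  have hGB : ∀ᵐ x ∂μ, ∀ t, |G t x| ≤ B := by
    filter_upwards [hFT, hFG] with x h1 h2 t
    rw [h2]
    exact h1 _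
  refine TendstoWeakStar.ae_eq_of_tendsto_lintegral hGv
    (hFw.comp_quasiMeasurePreserving hT hS hST (hw.measurable_tsum_mul hF) hwm)
    (hw.memLp_tsum_mul hG hGB)
    (fun n => (hw.memLp_tsum_mul hF hFB n).comp_of_top hT) hvt
    (hwt.comp_of_top hT) ?_
  have hlim : Tendsto (fun n => ENNReal.ofReal B *
      ∑' t, ∫⁻ x, ‖h n t x - h n (e t) (T x)‖ₑ ∂μ) U (𝓝 0) := by
    simpa using ENNReal.Tendsto.const_mul (happrox.mono_left hU) (Or.inr ENNReal.ofReal_ne_top)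
  refine tendsto_of_tendsto_of_tendsto_of_le_of_le tendsto_const_nhds hlim
    (fun _ => zero_le) fun n => ?_
  have hdm : ∀ t, Measurable fun x => ‖h n t x - h n (e t) (T x)‖ₑ := fun t =>
    ((hw.measurable n t).sub ((hw.measurable n (e t)).comp hT.measurable)).enorm
  dsimp only
  rw [← lintegral_tsum fun t => (hdm t).aemeasurable,
    ← lintegral_const_mul _ (Measurable.tsum hdm)]
  refine lintegral_mono_ae ?_
  filter_upwards [hFT, hFG, hGB] with x h1 h2 h3
  have hs := ((hw.summable n (T x)).mul_of_abs_le (fun t => hw.nonneg n t _) h1)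
  have hse : Summable fun t => h n (e t) (T x) * F (e t) (T x) := e.summable_iff.2 hs
  rw [← e.tsum_eq fun t => h n t (T x) * F t (T x),
    ← ((hw.summable n x).mul_of_abs_le (fun t => hw.nonneg n t x) h3).tsum_sub
      hse, ← ENNReal.tsum_mul_left]
  refine enorm_tsum_le_tsum_enorm.trans (ENNReal.tsum_le_tsum fun t => ?_)
  rw [h2, ← sub_mul, enorm_mul, mul_comm]
  gcongr
  rw [← ofReal_norm]
  exact ENNReal.ofReal_le_ofReal (h1 _)

/-- The density of the weak-star limit of weighted sums, as a linear map. -/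
lemma exists_linearMap_density [MeasurableSpace ι] (hw : IsBoundedWeight μ h C) (hfm : Measurable f)
    (hft : MemLp f ⊤ μ) (hpos : ∀ᵐ x ∂μ, 0 < f x)
    (hf : TendstoWeakStar μ U (fun n x => ∑' t, h n t x) f) :
    ∃ Φ : Lp ℝ ⊤ ((Measure.count : Measure ι).prod μ) →ₗ[ℝ] Lp ℝ ⊤ μ,
      ∀ F, TendstoWeakStar μ U (fun n x => ∑' t, h n t x * F (t, x)) fun x => f x * Φ F x := by
  choose Φ hΦ using fun F : Lp ℝ ⊤ ((Measure.count : Measure ι).prod μ) =>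
    hw.exists_density hfm hft hpos hf (Lp.measurable_section F) (Lp.ae_abs_section_le F)
  have hmem := fun F : Lp ℝ ⊤ ((Measure.count : Measure ι).prod μ) =>
    hw.memLp_tsum_mul (Lp.measurable_section F) (Lp.ae_abs_section_le F)
  refine ⟨⟨⟨Φ, fun F G => ?_⟩, fun c F => ?_⟩, hΦ⟩
  · refine TendstoWeakStar.density_unique hft hpos (hΦ (F + G))
      (((hΦ F).add (hΦ G) (hmem F) (hmem G) ((Lp.memLp _).mul hft)
        ((Lp.memLp _).mul hft)).congr (fun n => ?_) ?_)
    · filter_upwards [ae_forall_of_ae_count_prod (Lp.coeFn_add F G), Lp.ae_abs_section_le F,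
        Lp.ae_abs_section_le G] with x hx hF hG
      rw [← ((hw.summable n x).mul_of_abs_le (fun t => hw.nonneg n t x) hF).tsum_add
        ((hw.summable n x).mul_of_abs_le (fun t => hw.nonneg n t x) hG)]
      exact tsum_congr fun t => by rw [hx, Pi.add_apply, mul_add]
    · filter_upwards [Lp.coeFn_add (Φ F) (Φ G)] with x hx
      rw [hx, Pi.add_apply, mul_add]
  · refine TendstoWeakStar.density_unique hft hpos (hΦ (c • F))
      (((hΦ F).const_mul c).congr (fun n => ?_) ?_)
    · filter_upwards [ae_forall_of_ae_count_prod (Lp.coeFn_smul c F)] with x hx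
      rw [← tsum_mul_left]
      exact tsum_congr fun t => by rw [hx, Pi.smul_apply, smul_eq_mul]; ring
    · filter_upwards [Lp.coeFn_smul c (Φ F)] with x hx
      rw [RingHom.id_apply, hx, Pi.smul_apply, smul_eq_mul]
      ring

end IsBoundedWeight

lemma MeasureTheory.Measure.QuasiMeasurePreserving.restrict_of_ae_mem_iff {X : Type*}
    [MeasurableSpace X] {μ : Measure X} {T : X → X}
    (hT : Measure.QuasiMeasurePreserving T μ μ) {s : Set X} (hs : MeasurableSet s)
    (h : ∀ᵐ x ∂μ, T x ∈ s ↔ x ∈ s) :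
    Measure.QuasiMeasurePreserving T (μ.restrict s) (μ.restrict s) := by
  refine ⟨hT.measurable, Measure.AbsolutelyContinuous.mk fun N hN h0 => ?_⟩
  rw [Measure.map_apply hT.measurable hN, ← compl_compl (T ⁻¹' N), ← mem_ae_iff]
  have h1 : ∀ᵐ x ∂μ.restrict s, x ∉ N := measure_eq_zero_iff_ae_notMem.1 h0
  change ∀ᵐ x ∂μ.restrict s, T x ∉ N
  rw [ae_restrict_iff' hs] at h1 ⊢
  filter_upwards [hT.ae h1, h] with x hx hi hxs
  exact hx (hi.2 hxs)

/-- Asymptotic invariance of weights, expressed through lower Lebesgue integrals. -/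
lemma tendsto_tsum_lintegral_of_tendsto_tsum_integral {X ι : Type*} [MeasurableSpace X]
    {μ : Measure X} [IsFiniteMeasure μ] [Countable ι] {h : ℕ → ι → X → ℝ} {C : ℝ}
    (hw : IsBoundedWeight μ h C) {T : X → X} (hT : Measure.QuasiMeasurePreserving T μ μ)
    (e : ι ≃ ι)
    (happrox : Tendsto (fun n => ∑' t, ∫ x, |h n t x - h n (e t) (T x)| ∂μ) atTop (𝓝 0)) :
    Tendsto (fun n => ∑' t, ∫⁻ x, ‖h n t x - h n (e t) (T x)‖ₑ ∂μ) atTop (𝓝 0) := by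
  have hdm : ∀ n t, Measurable fun x => h n t x - h n (e t) (T x) := fun n t =>
    (hw.measurable n t).sub ((hw.measurable n (e t)).comp hT.measurable)
  have hfin : ∀ n, ∑' t, ∫⁻ x, ‖h n t x - h n (e t) (T x)‖ₑ ∂μ ≠ ∞ := by
    intro n
    rw [← lintegral_tsum fun t => (hdm n t).enorm.aemeasurable]
    have hle : ∫⁻ x, ∑' t, ‖h n t x - h n (e t) (T x)‖ₑ ∂μ ≤
        ∫⁻ _, ENNReal.ofReal C + ENNReal.ofReal C ∂μ := by
      refine lintegral_mono_ae ?_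
      filter_upwards [hw.tsum_le n, hT.ae (hw.tsum_le n)] with x h1 h2
      have key : ∀ y, ∑' t, h n t y ≤ C → ∑' t, ‖h n t y‖ₑ ≤ ENNReal.ofReal C := by
        intro y hy
        simp only [Real.enorm_of_nonneg (hw.nonneg n _ y)]
        rw [← ENNReal.ofReal_tsum_of_nonneg (fun t => hw.nonneg n t y) (hw.summable n y)]
        exact ENNReal.ofReal_le_ofReal hy
      calc ∑' t, ‖h n t x - h n (e t) (T x)‖ₑ
          ≤ ∑' t, (‖h n t x‖ₑ + ‖h n (e t) (T x)‖ₑ) :=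
            ENNReal.tsum_le_tsum fun t => enorm_sub_le
        _ = ∑' t, ‖h n t x‖ₑ + ∑' t, ‖h n t (T x)‖ₑ := by
            rw [ENNReal.tsum_add, e.tsum_eq fun t => ‖h n t (T x)‖ₑ]
        _ ≤ _ := add_le_add (key x h1) (key _ h2)
    refine (hle.trans_lt ?_).ne
    rw [lintegral_const]
    exact ENNReal.mul_lt_top (by simp) (measure_lt_top μ _)
  rw [← ENNReal.tendsto_toReal_iff hfin (by simp)]
  refine happrox.congr fun n => ?_
  rw [ENNReal.tsum_toReal_eq fun t => ENNReal.ne_top_of_tsum_ne_top (hfin n) t]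
  exact tsum_congr fun t =>
    integral_norm_eq_lintegral_enorm (hdm n t).aestronglyMeasurable

/-- core of Theorem 1 of the paper. Let `Γ ↷ (X,μ)` be a non-singular action
of a countable group on a standard probability space, `Ω ⊆ Γ` a conjugation-invariant subset,
and `(h_nᵗ)` nonnegative measurable functions with `sup_n ‖Σ_t h_nᵗ‖_∞ < ∞` and
`Σ_t ‖h_nᵗ − s·h_n^{s⁻¹ts}‖_{L¹} → 0` for every `s ∈ Γ`. If
`limsup_n ∫ Σ_{t∈Ω} h_nᵗ dμ > 0` then there is a `Γ`-invariant positive-measure set `X₀` and a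
`Γ`-equivariant conditional expectation `Φ : L∞(Ω × X₀) → L∞(X₀)`, where `Γ` acts on `Ω` by
conjugation. -/
theorem exists_invariant_component_with_equivariant_condexp
    {Γ X : Type*} [Group Γ] [Countable Γ]
    [MeasurableSpace Γ] [MeasurableSingletonClass Γ]
    [MeasurableSpace X] [StandardBorelSpace X]
    (μ : Measure X) [IsProbabilityMeasure μ]
    [MulAction Γ X]
    (hns : ∀ s : Γ, Measure.QuasiMeasurePreserving (fun x : X => s • x) μ μ)
    (Ω : Set Γ) (hΩ : ∀ s t : Γ, t ∈ Ω → s * t * s⁻¹ ∈ Ω)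
    (h : ℕ → Γ → X → ℝ)
    (hmeas : ∀ n t, Measurable (h n t))
    (hnonneg : ∀ n t x, 0 ≤ h n t x)
    (hsummable : ∀ n x, Summable fun t => h n t x)
    (C : ℝ) (hC : ∀ n, ∀ᵐ x ∂μ, (∑' t : Γ, h n t x) ≤ C)
    (happrox : ∀ s : Γ,
      Tendsto (fun n => ∑' t : Γ, ∫ x, |h n t x - h n (s⁻¹ * t * s) (s⁻¹ • x)| ∂μ)
        atTop (𝓝 0))
    (hlim : 0 < atTop.limsup fun n => ∫ x, (∑' t : Ω, h n (t : Γ) x) ∂μ) :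
    ∃ X₀ : Set X, MeasurableSet X₀ ∧ 0 < μ X₀ ∧
      (∀ s : Γ, μ ((s • X₀) ∆ X₀) = 0) ∧
      ∃ Φ : Lp ℝ ⊤ ((Measure.count : Measure Ω).prod (μ.restrict X₀)) →ₗ[ℝ]
            Lp ℝ ⊤ (μ.restrict X₀),
        -- positivity
        (∀ F, 0 ≤ F → 0 ≤ Φ F) ∧
        -- conditional expectation: Φ(1_Ω ⊗ f) = f
        (∀ (f : Lp ℝ ⊤ (μ.restrict X₀))
           (F : Lp ℝ ⊤ ((Measure.count : Measure Ω).prod (μ.restrict X₀))),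
           (⇑F =ᵐ[(Measure.count : Measure Ω).prod (μ.restrict X₀)] fun p => f p.2) →
           Φ F = f) ∧
        -- Γ-equivariance: Φ(s·F) = s·Φ(F), with Γ acting on Ω by conjugation
        (∀ (s : Γ) (F G : Lp ℝ ⊤ ((Measure.count : Measure Ω).prod (μ.restrict X₀))),
           (⇑G =ᵐ[(Measure.count : Measure Ω).prod (μ.restrict X₀)]
              fun p => F (⟨s⁻¹ * (p.1 : Γ) * s, by simpa using hΩ s⁻¹ p.1 p.1.2⟩, s⁻¹ • p.2)) →
           ∀ u : Lp ℝ ⊤ (μ.restrict X₀),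
             (⇑u =ᵐ[μ.restrict X₀] fun x => Φ F (s⁻¹ • x)) → Φ G = u) := by
  let e : Γ → Γ ≃ Γ := fun s =>
    ⟨fun t => s⁻¹ * t * s, fun t => s * t * s⁻¹, fun t => by group, fun t => by group⟩
  let eΩ : Γ → Ω ≃ Ω := fun s =>
    ⟨fun t => ⟨s⁻¹ * t * s, by simpa using hΩ s⁻¹ t t.2⟩,
      fun t => ⟨s * t * s⁻¹, hΩ s t t.2⟩,
      fun t => Subtype.ext (by simp; group), fun t => Subtype.ext (by simp; group)⟩
  have hwΓ : IsBoundedWeight μ h C := ⟨hmeas, hnonneg, hsummable, hC⟩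
  let k : ℕ → Ω → X → ℝ := fun n t => h n t
  have hksum : ∀ n x, Summable fun t => k n t x := fun n x => (hsummable n x).subtype Ω
  have hkle : ∀ n x, ∑' t, k n t x ≤ ∑' t, h n t x := fun n x =>
    (hsummable n x).tsum_subtype_le _ _ (hnonneg n · x)
  have hw : IsBoundedWeight μ k C := ⟨fun n t => hmeas n t, fun n t => hnonneg n t, hksum,
    fun n => (hC n).mono fun x hx => (hkle n x).trans hx⟩
  have hinv : ∀ s : Γ, Tendsto (fun n => ∑' t, ∫⁻ x, ‖k n t x - k n (eΩ s t) (s⁻¹ • x)‖ₑ ∂μ)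
      atTop (𝓝 0) := fun s =>
    tendsto_of_tendsto_of_tendsto_of_le_of_le tendsto_const_nhds
      (tendsto_tsum_lintegral_of_tendsto_tsum_integral hwΓ (hns s⁻¹) (e s) (happrox s))
      (fun _ => zero_le) fun n => ENNReal.tsum_comp_le_tsum_of_injective
        (f := ((↑) : Ω → Γ)) Subtype.val_injective
        (fun t => ∫⁻ x, ‖h n t x - h n (s⁻¹ * t * s) (s⁻¹ • x)‖ₑ ∂μ)
  -- an ultrafilter along which the total mass stays bounded below
  obtain ⟨δ, hδ, hδlim⟩ := exists_between hlim
  have hfreq : ∃ᶠ n in atTop, δ < ∫ x, ∑' t : Ω, h n t x ∂μ := by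
    have hbdd : IsBoundedUnder (· ≥ ·) atTop fun n => ∫ x, ∑' t : Ω, h n t x ∂μ :=
      isBoundedUnder_of ⟨0, fun n => integral_nonneg fun x =>
        tsum_nonneg fun t : Ω => hnonneg n (t : Γ) x⟩
    exact frequently_lt_of_lt_limsup hbdd.isCoboundedUnder_le hδlim
  have hne : (atTop ⊓ 𝓟 {n | δ < ∫ x, ∑' t : Ω, h n t x ∂μ}).NeBot := by
    rwa [← frequently_mem_iff_neBot]
  let U := Ultrafilter.of (atTop ⊓ 𝓟 {n | δ < ∫ x, ∑' t : Ω, h n t x ∂μ})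
  have hU : (U : Filter ℕ) ≤ atTop := (Ultrafilter.of_le _).trans inf_le_left
  have hUδ : ∀ᶠ n in (U : Filter ℕ), δ < ∫ x, ∑' t, k n t x ∂μ :=
    le_principal_iff.1 ((Ultrafilter.of_le _).trans inf_le_right)
  obtain ⟨f, hfm, hft, hf1⟩ := hw.exists_tendstoWeakStar U (F := fun _ _ => 1) (B := 1)
    (fun _ => measurable_const) (by simp)
  have hf : TendstoWeakStar μ U (fun n x => ∑' t, k n t x) f := by simpa using hf1
  have hfs : ∀ s : Γ, ∀ᵐ x ∂μ, f (s⁻¹ • x) = f x := fun s =>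
    (hw.ae_eq_comp hU (hns s⁻¹) (hns s) (fun x => smul_inv_smul s x) (eΩ s) (hinv s)
      (F := fun _ _ => 1) (G := fun _ _ => 1) (B := 1) (fun _ => measurable_const)
      (fun _ => measurable_const) (by simp) (by simp) hfm hft hft hf1 hf1).mono
      fun x hx => hx.symm
  have hX₀ : MeasurableSet {x | 0 < f x} := measurableSet_lt measurable_const hfm
  have hmem : ∀ s : Γ, ∀ᵐ x ∂μ, s⁻¹ • x ∈ {x | 0 < f x} ↔ x ∈ {x | 0 < f x} := fun s =>
    (hfs s).mono fun x hx => by simp [hx]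
  have hqmp : ∀ s : Γ, Measure.QuasiMeasurePreserving (fun x : X => s • x)
      (μ.restrict {x | 0 < f x}) (μ.restrict {x | 0 < f x}) := fun s =>
    (hns s).restrict_of_ae_mem_iff hX₀ (by simpa using hmem s⁻¹)
  refine ⟨{x | 0 < f x}, hX₀, ?_, fun s => ?_, ?_⟩
  · rw [pos_iff_ne_zero]
    intro h0
    have hfle : ∫ x, f x ∂μ ≤ 0 := integral_nonpos_of_ae <| by
      filter_upwards [measure_eq_zero_iff_ae_notMem.1 h0] with x hx using not_lt.1 hx
    have hlim' : Tendsto (fun n => ∫ x, ∑' t, k n t x ∂μ) U (𝓝 (∫ x, f x ∂μ)) := by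
      simpa using hf.tendsto_setIntegral MeasurableSet.univ
    exact absurd (ge_of_tendsto hlim' (hUδ.mono fun n hn => hn.le)) (by linarith)
  · rw [measure_symmDiff_eq_zero_iff]
    filter_upwards [hmem s] with x hx
    exact propext (Set.mem_smul_set_iff_inv_smul_mem.trans hx)
  set μ₀ := μ.restrict {x | 0 < f x}
  have hw₀ : IsBoundedWeight μ₀ k C := hw.restrict _
  have hpos : ∀ᵐ x ∂μ₀, 0 < f x := ae_restrict_mem hX₀
  have hft₀ : MemLp f ⊤ μ₀ := hft.restrict _
  have hf₀ : TendstoWeakStar μ₀ U (fun n x => ∑' t, k n t x) f := hf.restrict hX₀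
  have hinv₀ : ∀ s : Γ, Tendsto
      (fun n => ∑' t, ∫⁻ x, ‖k n t x - k n (eΩ s t) (s⁻¹ • x)‖ₑ ∂μ₀) atTop (𝓝 0) := fun s =>
    tendsto_of_tendsto_of_tendsto_of_le_of_le tendsto_const_nhds (hinv s)
      (fun _ => zero_le) fun n => ENNReal.tsum_le_tsum fun t => setLIntegral_le_lintegral _ _
  obtain ⟨Φ, hΦ⟩ := hw₀.exists_linearMap_density hfm hft₀ hpos hf₀
  refine ⟨Φ, fun F hF => ?_, fun g F hF => ?_, fun s F G hG u hu => ?_⟩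
  · rw [← Lp.coeFn_nonneg] at hF ⊢
    have h0 := (hΦ F).ae_nonneg ((Lp.memLp _).mul hft₀) fun n => by
      filter_upwards [ae_forall_of_ae_count_prod hF] with x hx
      exact tsum_nonneg fun t => mul_nonneg (hnonneg n t x) (hx t)
    filter_upwards [h0, hpos] with x h1 h2
    exact nonneg_of_mul_nonneg_right h1 h2
  · refine TendstoWeakStar.density_unique hft₀ hpos (hΦ F)
      ((hf₀.mul_right (Lp.memLp g)).congr (fun n => ?_) EventuallyEq.rfl)
    filter_upwards [ae_forall_of_ae_count_prod hF] with x hx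
    rw [← tsum_mul_right]
    exact tsum_congr fun t => by rw [hx]
  · have hΦm : Measurable fun x => f x * Φ F x :=
      hfm.mul (Lp.stronglyMeasurable (Φ F)).measurable
    have hkey := hw₀.ae_eq_comp hU (hqmp s⁻¹) (hqmp s) (fun x => smul_inv_smul s x) (eΩ s)
      (hinv₀ s) (Lp.measurable_section F) (Lp.measurable_section G) (Lp.ae_abs_section_le F)
      (ae_forall_of_ae_count_prod hG) hΦm ((Lp.memLp _).mul hft₀) ((Lp.memLp _).mul hft₀)
      (hΦ F) (hΦ G)
    apply Lp.ext
    filter_upwards [hkey, hu, ae_restrict_of_ae (hfs s), hpos] with x h1 h2 h3 h4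
    rw [h2]
    rw [h3] at h1
    exact mul_left_cancel₀ h4.ne' h1
end

section
/- Let Γ be a countable group with a non-singular strongly ergodic action on a standard probability space (X,μ), and let Λ ≤ Γ be a subgroup of finite index. Then there exists ε > 0 such that every sequence (E_n) of measurable subsets of X satisfying μ(sE_n △ E_n) → 0 for every s ∈ Λ and inf_n μ(E_n) > 0 must satisfy liminf_n μ(E_n) ≥ ε. -/
open MeasureTheory Filter Topology Pointwise
open scoped symmDiff

section CosetSaturation

variable {Γ X : Type*} [Group Γ] [MulAction Γ X]

/-- The union of the translates of a set by representatives of the left cosets of `Λ`. -/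
def cosetSaturation (Λ : Subgroup Γ) (A : Set X) : Set X :=
  ⋃ q : Γ ⧸ Λ, q.out • A

theorem smul_cosetSaturation_symmDiff_subset (Λ : Subgroup Γ) (s : Γ) (A : Set X) :
    (s • cosetSaturation Λ A) ∆ cosetSaturation Λ A ⊆
      ⋃ q : Γ ⧸ Λ, (s • q).out • ((((s • q).out⁻¹ * (s * q.out)) • A) ∆ A) := by
  have h : cosetSaturation Λ A = ⋃ q : Γ ⧸ Λ, (s • q).out • A :=
    ((MulAction.surjective s).iUnion_comp (fun q : Γ ⧸ Λ => q.out • A)).symm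
  conv_lhs => rw [h]
  rw [← h]
  nth_rewrite 2 [h]
  simp only [cosetSaturation, Set.smul_set_iUnion, Set.smul_set_symmDiff, smul_smul,
    mul_inv_cancel_left]
  rintro x (⟨hx, hx'⟩ | ⟨hx, hx'⟩)
  · obtain ⟨q, hq⟩ := Set.mem_iUnion.1 hx
    exact Set.mem_iUnion.2 ⟨q, Or.inl ⟨hq, fun h => hx' (Set.mem_iUnion.2 ⟨q, h⟩)⟩⟩
  · obtain ⟨q, hq⟩ := Set.mem_iUnion.1 hx
    exact Set.mem_iUnion.2 ⟨q, Or.inr ⟨hq, fun h => hx' (Set.mem_iUnion.2 ⟨q, h⟩)⟩⟩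

theorem out_smul_inv_mul_mem (Λ : Subgroup Γ) (s : Γ) (q : Γ ⧸ Λ) :
    (s • q).out⁻¹ * (s * q.out) ∈ Λ := by
  rw [← QuotientGroup.eq, QuotientGroup.out_eq', ← smul_eq_mul, ← MulAction.Quotient.smul_coe,
    QuotientGroup.out_eq']

end CosetSaturation

section NonsingularAction

variable {Γ X : Type*} [Group Γ] [MeasurableSpace X] [MulAction Γ X] {μ : Measure X}

theorem measurableSet_smul_of_quasiMeasurePreserving
    (hns : ∀ s : Γ, Measure.QuasiMeasurePreserving (fun x : X => s • x) μ μ)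
    (s : Γ) {A : Set X} (hA : MeasurableSet A) : MeasurableSet (s • A) := by
  rw [← Set.preimage_smul_inv]
  exact (hns s⁻¹).measurable hA

/-- Uniform absolute continuity of a single translation of a non-singular action. -/
theorem exists_pos_measure_smul_lt_of_quasiMeasurePreserving [IsFiniteMeasure μ]
    (hns : ∀ s : Γ, Measure.QuasiMeasurePreserving (fun x : X => s • x) μ μ)
    (s : Γ) {ε : ENNReal} (hε : ε ≠ 0) :
    ∃ δ > 0, ∀ A : Set X, MeasurableSet A → μ A < δ → μ (s • A) < ε := by
  have hac := (hns s⁻¹).absolutelyContinuous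
  obtain ⟨δ, hδ, h⟩ := exists_pos_setLIntegral_lt_of_measure_lt
    (Measure.lintegral_rnDeriv_lt_top (μ.map (fun x : X => s⁻¹ • x)) μ).ne hε
  refine ⟨δ, hδ, fun A hA hlt => ?_⟩
  have := h A hlt
  rwa [Measure.setLIntegral_rnDeriv hac, Measure.map_apply (hns s⁻¹).measurable hA,
    Set.preimage_smul_inv] at this

theorem tendsto_measure_smul_of_quasiMeasurePreserving [IsFiniteMeasure μ]
    (hns : ∀ s : Γ, Measure.QuasiMeasurePreserving (fun x : X => s • x) μ μ)
    (s : Γ) {A : ℕ → Set X} (hA : ∀ n, MeasurableSet (A n))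
    (h : Tendsto (fun n => μ (A n)) atTop (𝓝 0)) :
    Tendsto (fun n => μ (s • A n)) atTop (𝓝 0) := by
  rw [ENNReal.tendsto_nhds_zero]
  intro ε hε
  obtain ⟨δ, hδ, hs⟩ := exists_pos_measure_smul_lt_of_quasiMeasurePreserving hns s hε.ne'
  filter_upwards [h.eventually_lt_const hδ] with n hn
  exact (hs _ (hA n) hn).le

theorem tendsto_measure_smul_cosetSaturation_symmDiff [IsFiniteMeasure μ]
    (hns : ∀ s : Γ, Measure.QuasiMeasurePreserving (fun x : X => s • x) μ μ)
    (Λ : Subgroup Γ) [Λ.FiniteIndex] {E : ℕ → Set X} (hE : ∀ n, MeasurableSet (E n))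
    (hinv : ∀ s : Λ, Tendsto (fun n => μ (((s : Γ) • E n) ∆ (E n))) atTop (𝓝 0)) (s : Γ) :
    Tendsto (fun n => μ ((s • cosetSaturation Λ (E n)) ∆ cosetSaturation Λ (E n)))
      atTop (𝓝 0) := by
  have := Λ.fintypeQuotientOfFiniteIndex
  have hsum : Tendsto (fun n => ∑ q : Γ ⧸ Λ,
      μ ((s • q).out • ((((s • q).out⁻¹ * (s * q.out)) • E n) ∆ E n))) atTop (𝓝 0) := by
    rw [← Finset.sum_const_zero (s := (Finset.univ : Finset (Γ ⧸ Λ)))]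
    refine tendsto_finsetSum _ fun q _ => ?_
    exact tendsto_measure_smul_of_quasiMeasurePreserving hns _
      (fun n => (measurableSet_smul_of_quasiMeasurePreserving hns _ (hE n)).symmDiff (hE n))
      (hinv ⟨_, out_smul_inv_mul_mem Λ s q⟩)
  refine tendsto_of_tendsto_of_tendsto_of_le_of_le tendsto_const_nhds hsum
    (fun _ => zero_le) fun n => ?_
  exact (measure_mono (smul_cosetSaturation_symmDiff_subset Λ s (E n))).trans
    (measure_iUnion_fintype_le μ _)

/-- Sets of small measure have a coset saturation of small measure. -/
theorem exists_pos_measure_cosetSaturation_le [IsFiniteMeasure μ]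
    (hns : ∀ s : Γ, Measure.QuasiMeasurePreserving (fun x : X => s • x) μ μ)
    (Λ : Subgroup Γ) [Λ.FiniteIndex] {ε : ENNReal} (hε : ε ≠ 0) :
    ∃ δ > 0, ∀ A : Set X, MeasurableSet A → μ A < δ → μ (cosetSaturation Λ A) ≤ ε := by
  have := Λ.fintypeQuotientOfFiniteIndex
  have hc : ε / Fintype.card (Γ ⧸ Λ) ≠ 0 :=
    ENNReal.div_ne_zero.2 ⟨hε, ENNReal.natCast_ne_top _⟩
  choose δ hδ h using fun q : Γ ⧸ Λ =>
    exists_pos_measure_smul_lt_of_quasiMeasurePreserving hns q.out hc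
  refine ⟨Finset.univ.inf' Finset.univ_nonempty δ,
    (Finset.lt_inf'_iff _).2 fun q _ => hδ q, fun A hA hlt => ?_⟩
  calc μ (cosetSaturation Λ A) ≤ ∑ q : Γ ⧸ Λ, μ (q.out • A) := measure_iUnion_fintype_le μ _
    _ ≤ ∑ _q : Γ ⧸ Λ, ε / Fintype.card (Γ ⧸ Λ) := Finset.sum_le_sum fun q _ =>
        (h q A hA (hlt.trans_le (Finset.inf'_le _ (Finset.mem_univ q)))).le
    _ ≤ ε := by
        rw [Finset.sum_const, Finset.card_univ, nsmul_eq_mul]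
        exact ENNReal.mul_div_le

/-- The saturation of `A` contains a translate of `A`, so it cannot be small if `A` is not. -/
theorem exists_pos_le_measure_cosetSaturation [IsFiniteMeasure μ]
    (hns : ∀ s : Γ, Measure.QuasiMeasurePreserving (fun x : X => s • x) μ μ)
    (Λ : Subgroup Γ) {c : ENNReal} (hc : c ≠ 0) :
    ∃ δ > 0, ∀ A : Set X, MeasurableSet A → c ≤ μ A → δ ≤ μ (cosetSaturation Λ A) := by
  set g : Γ := ((1 : Γ) : Γ ⧸ Λ).out
  obtain ⟨δ, hδ, h⟩ := exists_pos_measure_smul_lt_of_quasiMeasurePreserving hns g⁻¹ hc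
  refine ⟨δ, hδ, fun A hA hle => ?_⟩
  have hgA : δ ≤ μ (g • A) := by
    by_contra! hlt
    have := h _ (measurableSet_smul_of_quasiMeasurePreserving hns g hA) hlt
    rw [inv_smul_smul] at this
    exact this.not_ge hle
  exact hgA.trans (measure_mono (Set.subset_iUnion (fun q : Γ ⧸ Λ => q.out • A) _))

theorem measurableSet_cosetSaturation
    (hns : ∀ s : Γ, Measure.QuasiMeasurePreserving (fun x : X => s • x) μ μ)
    (Λ : Subgroup Γ) [Λ.FiniteIndex] {A : Set X} (hA : MeasurableSet A) :
    MeasurableSet (cosetSaturation Λ A) :=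
  MeasurableSet.iUnion fun q => measurableSet_smul_of_quasiMeasurePreserving hns q.out hA

end NonsingularAction

/-- If a countable group `Γ` acts non-singularly and strongly ergodically on a
standard probability space `(X,μ)` and `Λ ≤ Γ` has finite index, then there is `ε > 0` such
that every sequence `(Eₙ)` of measurable sets which is asymptotically `Λ`-invariant and
satisfies `inf_n μ(Eₙ) > 0` has `liminf_n μ(Eₙ) ≥ ε`. -/
theorem liminf_bound_of_finite_index_asymptotically_invariant
    {Γ X : Type*} [Group Γ] [Countable Γ]
    [MeasurableSpace X] [StandardBorelSpace X]
    (μ : Measure X) [IsProbabilityMeasure μ]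
    [MulAction Γ X]
    (hns : ∀ s : Γ, Measure.QuasiMeasurePreserving (fun x : X => s • x) μ μ)
    (hse : ∀ E : ℕ → Set X, (∀ n, MeasurableSet (E n)) →
      (∀ s : Γ, Tendsto (fun n => μ ((s • E n) ∆ (E n))) atTop (𝓝 0)) →
      Tendsto (fun n => μ (E n) * (1 - μ (E n))) atTop (𝓝 0))
    (Λ : Subgroup Γ) [Λ.FiniteIndex] :
    ∃ ε : ENNReal, 0 < ε ∧
      ∀ E : ℕ → Set X, (∀ n, MeasurableSet (E n)) →
        (∀ s : Λ, Tendsto (fun n => μ (((s : Γ) • E n) ∆ (E n))) atTop (𝓝 0)) →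
        0 < ⨅ n, μ (E n) →
        ε ≤ atTop.liminf (fun n => μ (E n)) := by
  obtain ⟨ε, hε, hsmall⟩ := exists_pos_measure_cosetSaturation_le hns Λ
    (ε := 2⁻¹) (by simp)
  refine ⟨ε, hε, fun E hE hinv hinf => ?_⟩
  obtain ⟨δ, hδ, hbig⟩ := exists_pos_le_measure_cosetSaturation hns Λ hinf.ne'
  have hlim := hse (fun n => cosetSaturation Λ (E n))
    (fun n => measurableSet_cosetSaturation hns Λ (hE n))
    (tendsto_measure_smul_cosetSaturation_symmDiff hns Λ hE hinv)
  have hpos : 0 < δ * 2⁻¹ := ENNReal.mul_pos hδ.ne' (by simp)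
  refine le_liminf_of_le (by isBoundedDefault) ?_
  filter_upwards [hlim.eventually_lt_const hpos] with n hn
  by_contra! hlt
  refine hn.not_ge (mul_le_mul' (hbig _ (hE n) (iInf_le _ n)) ?_)
  rw [← ENNReal.one_sub_inv_two]
  exact tsub_le_tsub_left (hsmall _ (hE n) hlt) 1
end

section
/- Let Γ be a countable group with a non-singular strongly ergodic action on a standard probability space (X,μ), and let Λ ≤ Γ be a subgroup of finite index. Then the restricted action Λ ↷ (X,μ) decomposes into finitely many ergodic components, each of which is strongly ergodic: there exist finitely many pairwise disjoint Λ-invariant measurable subsets X₁, …, X_k of X, each of positive measure, whose union is conull in X, such that for each i the restricted action Λ ↷ (X_i, μ(X_i)⁻¹ μ|_{X_i}) is ergodic and strongly ergodic. -/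
open MeasureTheory Filter Topology Pointwise
open scoped symmDiff ENNReal

theorem MeasureTheory.Measure.AbsolutelyContinuous.tendsto_measure_zero
    {X ι : Type*} [MeasurableSpace X] {μ ν : Measure X} [SigmaFinite μ] [IsFiniteMeasure ν]
    (h : ν ≪ μ) {l : Filter ι} {A : ι → Set X} (hA : Tendsto (fun i => μ (A i)) l (𝓝 0)) :
    Tendsto (fun i => ν (A i)) l (𝓝 0) := by
  have key := tendsto_setLIntegral_zero (μ := μ) (f := ν.rnDeriv μ)
    (Measure.lintegral_rnDeriv_lt_top ν μ).ne hA
  refine key.congr fun i => ?_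
  rw [← withDensity_apply', Measure.withDensity_rnDeriv_eq ν μ h]

section AlmostInvariant

variable {Γ X : Type*} [Group Γ] [MeasurableSpace X] [MulAction Γ X] {μ : Measure X}

/-- The filter of `H`-almost invariant measurable sets: a family of measurable sets tends to it iff
each element of `H` moves the sets by an amount tending to zero in measure. -/
def almostInvariant (μ : Measure X) (H : Subgroup Γ) : Filter (Set X) :=
  𝓟 {E | MeasurableSet E} ⊓ ⨅ s : H, comap (fun E => μ (((s : Γ) • E) ∆ E)) (𝓝 0)

instance almostInvariant.isCountablyGenerated [Countable Γ] (H : Subgroup Γ) :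
    (almostInvariant μ H).IsCountablyGenerated := by
  unfold almostInvariant
  infer_instance

theorem tendsto_almostInvariant_iff {ι : Type*} {l : Filter ι} {H : Subgroup Γ} {E : ι → Set X} :
    Tendsto E l (almostInvariant μ H) ↔ (∀ᶠ i in l, MeasurableSet (E i)) ∧
      ∀ s : H, Tendsto (fun i => μ (((s : Γ) • E i) ∆ E i)) l (𝓝 0) := by
  simp [almostInvariant, tendsto_inf, tendsto_iInf, tendsto_comap_iff, Function.comp_def]

theorem tendsto_measure_smul_zero [IsFiniteMeasure μ]
    (hns : ∀ s : Γ, Measure.QuasiMeasurePreserving (fun x : X => s • x) μ μ)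
    {ι : Type*} {l : Filter ι} {A : ι → Set X} (hA : Tendsto (fun i => μ (A i)) l (𝓝 0)) (s : Γ) :
    Tendsto (fun i => μ (s • A i)) l (𝓝 0) := by
  refine tendsto_of_tendsto_of_tendsto_of_le_of_le tendsto_const_nhds
    ((hns s⁻¹).absolutelyContinuous.tendsto_measure_zero hA) (fun _ => zero_le) fun i => ?_
  have h := Measure.le_map_apply (hns s⁻¹).aemeasurable (A i)
  rwa [Set.preimage_smul_inv] at h

theorem tendsto_measure_zero_of_subset_iUnion {ι κ : Type*} [Finite κ] {l : Filter ι}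
    {A : ι → Set X} {B : κ → ι → Set X} (h : ∀ i, A i ⊆ ⋃ k, B k i)
    (hB : ∀ k, Tendsto (fun i => μ (B k i)) l (𝓝 0)) :
    Tendsto (fun i => μ (A i)) l (𝓝 0) := by
  have := Fintype.ofFinite κ
  have hsum : Tendsto (fun i => ∑ k, μ (B k i)) l (𝓝 0) := by
    simpa using tendsto_finsetSum Finset.univ fun k _ => hB k
  refine tendsto_of_tendsto_of_tendsto_of_le_of_le tendsto_const_nhds hsum
    (fun _ => zero_le) fun i => ?_
  exact (measure_mono (h i)).trans (measure_iUnion_fintype_le μ fun k => B k i)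

theorem Filter.Tendsto.almostInvariant_compl {ι : Type*} {l : Filter ι} {H : Subgroup Γ}
    {E : ι → Set X} (h : Tendsto E l (almostInvariant μ H)) :
    Tendsto (fun i => (E i)ᶜ) l (almostInvariant μ H) := by
  rw [tendsto_almostInvariant_iff] at h ⊢
  refine ⟨h.1.mono fun i hi => hi.compl, fun s => (h.2 s).congr fun i => ?_⟩
  rw [Set.smul_set_compl, compl_symmDiff_compl]

theorem Filter.Tendsto.almostInvariant_iInter {ι κ : Type*} [Finite κ] {l : Filter ι}
    {H : Subgroup Γ} {E : κ → ι → Set X} (h : ∀ k, Tendsto (E k) l (almostInvariant μ H)) :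
    Tendsto (fun i => ⋂ k, E k i) l (almostInvariant μ H) := by
  simp only [tendsto_almostInvariant_iff] at h ⊢
  refine ⟨?_, fun s => ?_⟩
  · filter_upwards [eventually_all.2 fun k => (h k).1] with i hi
    exact .iInter hi
  · refine tendsto_measure_zero_of_subset_iUnion (fun i x hx => ?_) fun k => (h k).2 s
    simp only [Set.smul_set_iInter, Set.mem_symmDiff, Set.mem_iInter, Set.mem_iUnion,
      not_forall] at hx ⊢
    rcases hx with ⟨h1, k, hk⟩ | ⟨h1, k, hk⟩
    · exact ⟨k, .inl ⟨h1 k, hk⟩⟩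
    · exact ⟨k, .inr ⟨h1 k, hk⟩⟩

/-- The union of the translates of an almost `Λ`-invariant set over representatives of `Γ ⧸ Λ`
is almost `Γ`-invariant. -/
theorem tendsto_iUnion_smul_almostInvariant_top [IsFiniteMeasure μ]
    (hns : ∀ s : Γ, Measure.QuasiMeasurePreserving (fun x : X => s • x) μ μ)
    (Λ : Subgroup Γ) [Λ.FiniteIndex] :
    Tendsto (fun E : Set X => ⋃ q : Γ ⧸ Λ, q.out • E) (almostInvariant μ Λ)
      (almostInvariant μ (⊤ : Subgroup Γ)) := by
  have : MeasurableConstSMul Γ X := ⟨fun s => (hns s).measurable⟩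
  obtain ⟨hm, hinv⟩ := tendsto_almostInvariant_iff.1 (tendsto_id (x := almostInvariant μ Λ))
  refine tendsto_almostInvariant_iff.2 ⟨?_, fun ⟨s, _⟩ => ?_⟩
  · filter_upwards [hm] with E hE
    exact .iUnion fun q => hE.const_smul _
  have hcoset (q : Γ ⧸ Λ) : ((s • q).out)⁻¹ * (s * q.out) ∈ Λ := by
    rw [← QuotientGroup.eq, QuotientGroup.out_eq', ← smul_eq_mul s, ← MulAction.Quotient.smul_coe,
      QuotientGroup.out_eq']
  refine tendsto_measure_zero_of_subset_iUnion (κ := Γ ⧸ Λ)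
    (B := fun q E => (s • q).out • (((((s • q).out)⁻¹ * (s * q.out)) • E) ∆ E)) (fun E => ?_)
    fun q => tendsto_measure_smul_zero hns (hinv ⟨_, hcoset q⟩) _
  have h1 : (⋃ q : Γ ⧸ Λ, q.out • E) = ⋃ q : Γ ⧸ Λ, (s • q).out • E :=
    ((MulAction.toPerm s).surjective.iUnion_comp fun q : Γ ⧸ Λ => q.out • E).symm
  have h2 : s • (⋃ q : Γ ⧸ Λ, q.out • E) =
      ⋃ q : Γ ⧸ Λ, (s • q).out • (((s • q).out)⁻¹ * (s * q.out)) • E := by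
    simp only [Set.smul_set_iUnion, smul_smul, mul_inv_cancel_left]
  intro x hx
  change x ∈ (s • (⋃ q : Γ ⧸ Λ, q.out • E)) ∆ (⋃ q : Γ ⧸ Λ, q.out • E) at hx
  rw [h2, h1] at hx
  simp only [Set.smul_set_symmDiff, Set.mem_symmDiff, Set.mem_iUnion, not_exists] at hx ⊢
  rcases hx with ⟨⟨q, hq⟩, hn⟩ | ⟨⟨q, hq⟩, hn⟩
  · exact ⟨q, .inl ⟨hq, hn q⟩⟩
  · exact ⟨q, .inr ⟨hq, hn q⟩⟩

theorem tendsto_measure_mul_one_sub_almostInvariant_top [Countable Γ]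
    (hse : ∀ E : ℕ → Set X, (∀ n, MeasurableSet (E n)) →
      (∀ s : Γ, Tendsto (fun n => μ ((s • E n) ∆ (E n))) atTop (𝓝 0)) →
      Tendsto (fun n => μ (E n) * (1 - μ (E n))) atTop (𝓝 0)) :
    Tendsto (fun E => μ E * (1 - μ E)) (almostInvariant μ (⊤ : Subgroup Γ)) (𝓝 0) := by
  classical
  refine tendsto_of_seq_tendsto fun u hu => ?_
  obtain ⟨hm, hinv⟩ := tendsto_almostInvariant_iff.1 hu
  have heq : ∀ᶠ n in atTop, (if MeasurableSet (u n) then u n else ∅) = u n :=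
    hm.mono fun n hn => if_pos hn
  refine (hse (fun n => if MeasurableSet (u n) then u n else ∅) (fun n => ?_) fun s => ?_).congr' ?_
  · split_ifs with h
    exacts [h, .empty]
  · refine (hinv ⟨s, trivial⟩).congr' ?_
    filter_upwards [heq] with n hn
    rw [hn]
  · filter_upwards [heq] with n hn
    simp [hn]

/-- There is a threshold such that almost `Λ`-invariant sets of measure below it have measure
tending to zero. -/
theorem exists_tendsto_measure_almostInvariant_inf_principal [Countable Γ] [IsProbabilityMeasure μ]
    (hns : ∀ s : Γ, Measure.QuasiMeasurePreserving (fun x : X => s • x) μ μ)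
    (hse : ∀ E : ℕ → Set X, (∀ n, MeasurableSet (E n)) →
      (∀ s : Γ, Tendsto (fun n => μ ((s • E n) ∆ (E n))) atTop (𝓝 0)) →
      Tendsto (fun n => μ (E n) * (1 - μ (E n))) atTop (𝓝 0))
    (Λ : Subgroup Γ) [Λ.FiniteIndex] :
    ∃ δ > 0, Tendsto μ (almostInvariant μ Λ ⊓ 𝓟 {E | μ E < δ}) (𝓝 0) := by
  set F : Set X → Set X := fun E => ⋃ q : Γ ⧸ Λ, q.out • E
  have hsmall : Tendsto (fun E => μ (F E)) (comap μ (𝓝 0)) (𝓝 0) :=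
    tendsto_measure_zero_of_subset_iUnion (fun E => subset_rfl) fun q =>
      tendsto_measure_smul_zero hns tendsto_comap _
  have hhalf : ∀ᶠ E in comap μ (𝓝 0), μ (F E) < 2⁻¹ :=
    hsmall.eventually (gt_mem_nhds (by simp))
  obtain ⟨δ, hδ, hlt⟩ := (ENNReal.nhds_zero_basis.comap μ).eventually_iff.1 hhalf
  refine ⟨δ, hδ, ?_⟩
  have hprod : Tendsto (fun E => 2 * (μ (F E) * (1 - μ (F E)))) (almostInvariant μ Λ) (𝓝 0) := by
    simpa using ENNReal.Tendsto.const_mul ((tendsto_measure_mul_one_sub_almostInvariant_top hse).comp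
      (tendsto_iUnion_smul_almostInvariant_top hns Λ)) (.inr (by simp : (2 : ℝ≥0∞) ≠ ⊤))
  have hFE : Tendsto (fun E => μ (F E)) (almostInvariant μ Λ ⊓ 𝓟 {E | μ E < δ}) (𝓝 0) := by
    refine tendsto_of_tendsto_of_tendsto_of_le_of_le' tendsto_const_nhds
      (hprod.mono_left inf_le_left) (.of_forall fun _ => zero_le) ?_
    refine eventually_inf_principal.2 (.of_forall fun E hE => ?_)
    have h2 : 2⁻¹ ≤ 1 - μ (F E) := by
      rw [← ENNReal.one_sub_inv_two]
      exact tsub_le_tsub_left (hlt hE).le _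
    calc μ (F E) = 2 * (μ (F E) * 2⁻¹) := by
          rw [mul_left_comm, ENNReal.mul_inv_cancel (by simp) (by simp), mul_one]
      _ ≤ 2 * (μ (F E) * (1 - μ (F E))) := by gcongr
  refine tendsto_of_tendsto_of_tendsto_of_le_of_le tendsto_const_nhds
    (tendsto_measure_smul_zero hns hFE ((1 : Γ) : Γ ⧸ Λ).out⁻¹) (fun _ => zero_le) fun E => ?_
  refine measure_mono (Set.subset_smul_set_iff.2 ?_)
  rw [inv_inv]
  exact Set.subset_iUnion (fun q : Γ ⧸ Λ => q.out • E) _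

end AlmostInvariant

section Convergence

variable {Γ X : Type*} [Group Γ] [MeasurableSpace X] [MulAction Γ X] {μ : Measure X}

/-- Among sufficiently many sufficiently invariant sets, two are close in measure. -/
theorem exists_eventually_pi_almostInvariant [IsProbabilityMeasure μ] {H : Subgroup Γ} {δ : ℝ≥0∞}
    (hδ : 0 < δ) (h : Tendsto μ (almostInvariant μ H ⊓ 𝓟 {E | μ E < δ}) (𝓝 0)) :
    ∃ k : ℕ, ∀ ε > 0, ∀ᶠ E in Filter.pi (fun _ : Fin k => almostInvariant μ H),
      ∃ i j, i ≠ j ∧ μ (E i ∆ E j) < ε := by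
  classical
  obtain ⟨N, hN⟩ := ENNReal.exists_nat_mul_gt hδ.ne' ENNReal.one_ne_top
  refine ⟨2 ^ N + 1, fun ε hε => ?_⟩
  generalize hk : 2 ^ N + 1 = k
  set atom : Finset (Fin k) → (Fin k → Set X) → Set X :=
    fun σ E => ⋂ i, if i ∈ σ then E i else (E i)ᶜ with hatom
  have mem_atom (σ E x) : x ∈ atom σ E ↔ ∀ i, i ∈ σ ↔ x ∈ E i := by
    simp only [hatom, Set.mem_iInter]
    refine forall_congr' fun i => ?_
    split_ifs with hi <;> simp [hi]
  have hatom_tendsto (σ) : Tendsto (atom σ) (Filter.pi fun _ : Fin k => almostInvariant μ H)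
      (almostInvariant μ H) := by
    refine Tendsto.almostInvariant_iInter fun i => ?_
    split_ifs
    exacts [tendsto_eval_pi _ i, (tendsto_eval_pi _ i).almostInvariant_compl]
  have hif : Tendsto (fun E => if μ E < δ then μ E else 0) (almostInvariant μ H) (𝓝 0) :=
    h.if tendsto_const_nhds
  have hsum : Tendsto (fun E => ∑ σ, if μ (atom σ E) < δ then μ (atom σ E) else 0)
      (Filter.pi fun _ : Fin k => almostInvariant μ H) (𝓝 0) := by
    simpa using tendsto_finsetSum Finset.univ fun σ _ => hif.comp (hatom_tendsto σ)
  filter_upwards [hsum.eventually (gt_mem_nhds hε),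
    eventually_all.2 fun σ => (tendsto_almostInvariant_iff.1 (hatom_tendsto σ)).1] with E hE hm
  set B : Finset (Finset (Fin k)) := {σ | δ ≤ μ (atom σ E)}
  have hBcard : B.card ≤ N := by
    have h1 : ∑ σ ∈ B, μ (atom σ E) ≤ 1 := by
      rw [← measure_univ (μ := μ)]
      refine sum_measure_le_measure_univ (fun σ _ => (hm σ).nullMeasurableSet)
        fun σ _ τ _ hστ => Disjoint.aedisjoint (Set.disjoint_left.2 fun x hx hx' => hστ ?_)
      ext i
      rw [(mem_atom _ _ _).1 hx, (mem_atom _ _ _).1 hx']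
    have h2 : (B.card : ℝ≥0∞) * δ ≤ 1 := by
      rw [← nsmul_eq_mul]
      exact (Finset.card_nsmul_le_sum B _ δ fun σ hσ => (Finset.mem_filter.1 hσ).2).trans h1
    by_contra! hlt
    have : (N : ℝ≥0∞) * δ ≤ B.card * δ := by gcongr
    exact absurd (hN.trans_le (this.trans h2)) (lt_irrefl _)
  obtain ⟨i, j, hij, hBij⟩ : ∃ i j, i ≠ j ∧ ∀ σ ∈ B, i ∈ σ ↔ j ∈ σ := by
    have hcard : B.powerset.card < (Finset.univ : Finset (Fin k)).card := by
      rw [Finset.card_powerset, Finset.card_univ, Fintype.card_fin]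
      exact (Nat.lt_succ_of_le (Nat.pow_le_pow_right two_pos hBcard)).trans_eq hk
    obtain ⟨i, -, j, -, hij, heq⟩ := Finset.exists_ne_map_eq_of_card_lt_of_maps_to hcard
      (f := fun i => B.filter fun σ => i ∈ σ)
      (fun i _ => Finset.mem_powerset.2 (Finset.filter_subset _ _))
    exact ⟨i, j, hij, fun σ hσ => by simpa [hσ] using Finset.ext_iff.1 heq σ⟩
  refine ⟨i, j, hij, lt_of_le_of_lt ?_ hE⟩
  have hsub : E i ∆ E j ⊆ ⋃ σ, if μ (atom σ E) < δ then atom σ E else ∅ := by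
    intro x hx
    refine Set.mem_iUnion.2 ⟨({l | x ∈ E l} : Finset (Fin k)), ?_⟩
    rw [if_pos]
    · simp [mem_atom]
    · by_contra! hle
      have := hBij _ (Finset.mem_filter.2 ⟨Finset.mem_univ _, hle⟩)
      simp only [Finset.mem_filter, Finset.mem_univ, true_and] at this
      simp [Set.mem_symmDiff, this] at hx
  refine (measure_mono hsub).trans ((measure_iUnion_fintype_le μ _).trans
    (Finset.sum_le_sum fun σ _ => ?_))
  split_ifs <;> simp

/-- Completeness of the measure algebra, in terms of filters. -/
theorem exists_tendsto_measure_symmDiff {l : Filter (Set X)} [l.NeBot]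
    (h : ∀ ε > 0, ∃ B, MeasurableSet B ∧ ∀ᶠ E in l, μ (E ∆ B) < ε) :
    ∃ A, MeasurableSet A ∧ Tendsto (fun E => μ (E ∆ A)) l (𝓝 0) := by
  obtain ⟨ε, hε, hsum⟩ := ENNReal.exists_pos_sum_of_countable' (ε := 1) one_ne_zero ℕ
  choose B hB hBl using fun n => h (ε n) (hε n)
  set η : ℕ → ℝ≥0∞ := fun n => ε n + ε (n + 1) with hη
  have hηsum : ∑' n, η n ≠ ⊤ := by
    rw [hη, ENNReal.tsum_add]
    refine ENNReal.add_ne_top.2 ⟨hsum.ne_top, ne_top_of_le_ne_top hsum.ne_top ?_⟩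
    exact ENNReal.tsum_comp_le_tsum_of_injective (add_left_injective 1) ε
  have hstep (n) : μ (B n ∆ B (n + 1)) ≤ η n := by
    obtain ⟨E, h1, h2⟩ := ((hBl n).and (hBl (n + 1))).exists
    rw [symmDiff_comm] at h1
    exact (measure_symmDiff_le _ _ _).trans (add_le_add h1.le h2.le)
  set A : Set X := ⋃ n, ⋂ m, B (n + m) with hA
  have hsub (n) : B n ∆ A ⊆ ⋃ m, B (m + n) ∆ B (m + n + 1) := by
    intro x hx
    by_contra hcon
    simp only [Set.mem_iUnion, not_exists, Set.mem_symmDiff, not_or, not_and, not_not] at hcon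
    have hconst (m) : x ∈ B (m + n) ↔ x ∈ B n := by
      induction m with
      | zero => simp
      | succ m ih =>
        rw [← ih, show m + 1 + n = m + n + 1 by ring]
        exact ⟨(hcon m).2, (hcon m).1⟩
    have hiff : x ∈ A ↔ x ∈ B n := by
      simp only [hA, Set.mem_iUnion, Set.mem_iInter]
      constructor
      · rintro ⟨p, hp⟩
        rw [← hconst p]
        exact hp n
      · intro hx
        exact ⟨n, fun m => by rw [add_comm, hconst]; exact hx⟩
    simp [Set.mem_symmDiff, hiff] at hx
  refine ⟨A, .iUnion fun n => .iInter fun m => hB _, ?_⟩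
  have hbound (n) : ∀ᶠ E in l, μ (E ∆ A) ≤ ε n + ∑' m, η (m + n) := by
    filter_upwards [hBl n] with E hE
    refine (measure_symmDiff_le E (B n) A).trans (add_le_add hE.le ?_)
    exact (measure_mono (hsub n)).trans ((measure_iUnion_le _).trans
      (ENNReal.tsum_le_tsum fun m => hstep _))
  have hlim : Tendsto (fun n => ε n + ∑' m, η (m + n)) atTop (𝓝 0) := by
    simpa using (ENNReal.tendsto_atTop_zero_of_tsum_ne_top hsum.ne_top).add
      (ENNReal.tendsto_sum_nat_add η hηsum)
  refine ENNReal.tendsto_nhds_zero.2 fun r hr => ?_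
  obtain ⟨n, hn⟩ := (hlim.eventually (gt_mem_nhds hr)).exists
  exact (hbound n).mono fun E hE => hE.trans hn.le

theorem measure_smul_symmDiff_eq_zero_of_tendsto [IsFiniteMeasure μ]
    (hns : ∀ s : Γ, Measure.QuasiMeasurePreserving (fun x : X => s • x) μ μ)
    {H : Subgroup Γ} {l : Filter (Set X)} [l.NeBot] (hl : l ≤ almostInvariant μ H) {A : Set X}
    (hA : Tendsto (fun E => μ (E ∆ A)) l (𝓝 0)) (s : H) :
    μ (((s : Γ) • A) ∆ A) = 0 := by
  have hid := (tendsto_almostInvariant_iff.1 (tendsto_id'.2 hl)).2 s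
  have hlim := ((tendsto_measure_smul_zero hns hA (s : Γ)).add hid).add hA
  simp only [add_zero, id] at hlim
  refine le_antisymm (ge_of_tendsto' hlim fun E => ?_) zero_le
  calc μ (((s : Γ) • A) ∆ A)
      ≤ μ (((s : Γ) • A) ∆ ((s : Γ) • E)) + μ (((s : Γ) • E) ∆ A) := measure_symmDiff_le _ _ _
    _ ≤ μ (((s : Γ) • A) ∆ ((s : Γ) • E)) + (μ (((s : Γ) • E) ∆ E) + μ (E ∆ A)) := by
        gcongr
        exact measure_symmDiff_le _ _ _
    _ = _ := by rw [Set.smul_set_symmDiff, symmDiff_comm ((s : Γ) • A), add_assoc]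

/-- Any ultrafilter of almost invariant sets converges in measure to an invariant set. -/
theorem exists_tendsto_ultrafilter_almostInvariant [IsProbabilityMeasure μ]
    {H : Subgroup Γ} {δ : ℝ≥0∞} (hδ : 0 < δ)
    (h : Tendsto μ (almostInvariant μ H ⊓ 𝓟 {E | μ E < δ}) (𝓝 0))
    {𝒰 : Ultrafilter (Set X)} (h𝒰 : ↑𝒰 ≤ almostInvariant μ H) :
    ∃ A, MeasurableSet A ∧ Tendsto (fun E => μ (E ∆ A)) 𝒰 (𝓝 0) := by
  refine exists_tendsto_measure_symmDiff fun ε hε => ?_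
  by_contra! hcon
  obtain ⟨k, hk⟩ := exists_eventually_pi_almostInvariant hδ h
  obtain ⟨I, t, ht, hsub⟩ := Filter.mem_pi'.1 (hk ε hε)
  have : Std.Symm fun E E' : Set X => ε ≤ μ (E ∆ E') :=
    ⟨fun E E' hE => by rwa [symmDiff_comm]⟩
  obtain ⟨f, hf, hfar⟩ := exists_seq_of_forall_finset_exists'
    (fun E : Set X => MeasurableSet E ∧ ∀ i ∈ I, E ∈ t i) (fun E E' => ε ≤ μ (E ∆ E'))
    fun s hs => by
      have h1 : ∀ᶠ E in (𝒰 : Filter (Set X)), ∀ i ∈ I, E ∈ t i :=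
        (Filter.eventually_all_finset I).2 fun i _ => h𝒰 (ht i)
      have h2 : ∀ᶠ E in (𝒰 : Filter (Set X)), MeasurableSet E :=
        (tendsto_almostInvariant_iff.1 (tendsto_id'.2 h𝒰)).1
      have h3 : ∀ᶠ E in (𝒰 : Filter (Set X)), ∀ x ∈ s, ε ≤ μ (x ∆ E) := by
        refine (Filter.eventually_all_finset s).2 fun x hx => ?_
        simpa only [symmDiff_comm x] using hcon x (hs x hx).1
      obtain ⟨E, h1, h2, h3⟩ := (h1.and (h2.and h3)).exists
      exact ⟨E, ⟨h2, h1⟩, h3⟩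
  obtain ⟨i, j, hij, hlt⟩ := hsub (show (fun i : Fin k => f i) ∈ _ from fun i hi => (hf i).2 i hi)
  exact hlt.not_ge (hfar (Fin.val_injective.ne hij))

end Convergence

section Decomposition

variable {Γ X : Type*} [Group Γ] [MeasurableSpace X] [MulAction Γ X] {μ : Measure X}

theorem Filter.Tendsto.almostInvariant_inter {ι : Type*} {l : Filter ι} {H : Subgroup Γ}
    {E F : ι → Set X} (hE : Tendsto E l (almostInvariant μ H))
    (hF : Tendsto F l (almostInvariant μ H)) :
    Tendsto (fun i => E i ∩ F i) l (almostInvariant μ H) := by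
  simp only [Set.inter_eq_iInter]
  refine (Tendsto.almostInvariant_iInter (κ := Bool) (E := fun b i => cond b (E i) (F i)) ?_)
  rintro (_ | _)
  exacts [hF, hE]

theorem pure_le_almostInvariant_iff {H : Subgroup Γ} {A : Set X} :
    pure A ≤ almostInvariant μ H ↔ MeasurableSet A ∧ ∀ s : H, μ (((s : Γ) • A) ∆ A) = 0 := by
  rw [← tendsto_id', tendsto_almostInvariant_iff]
  refine and_congr (by simp) (forall_congr' fun s => ⟨fun h => ?_, fun h => ?_⟩)
  · exact tendsto_nhds_unique (tendsto_pure_nhds (fun E => μ (((s : Γ) • E) ∆ E)) A) h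
  · simpa [h] using tendsto_pure_nhds (fun E => μ (((s : Γ) • E) ∆ E)) A

theorem pure_compl_le_almostInvariant {H : Subgroup Γ} {A : Set X}
    (hA : pure A ≤ almostInvariant μ H) : pure Aᶜ ≤ almostInvariant μ H := by
  simpa [Tendsto] using (tendsto_id'.2 hA).almostInvariant_compl

theorem pure_inter_le_almostInvariant {H : Subgroup Γ} {A B : Set X}
    (hA : pure A ≤ almostInvariant μ H) (hB : pure B ≤ almostInvariant μ H) :
    pure (A ∩ B) ≤ almostInvariant μ H := by
  have hB' : Tendsto (fun _ => B) (pure A) (almostInvariant μ H) := by simpa [Tendsto] using hB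
  simpa [Tendsto] using (tendsto_id'.2 hA).almostInvariant_inter hB'

theorem pure_sdiff_le_almostInvariant {H : Subgroup Γ} {A B : Set X}
    (hA : pure A ≤ almostInvariant μ H) (hB : pure B ≤ almostInvariant μ H) :
    pure (A \ B) ≤ almostInvariant μ H :=
  pure_inter_le_almostInvariant hA (pure_compl_le_almostInvariant hB)

theorem pure_iUnion_le_almostInvariant {κ : Type*} [Finite κ] {H : Subgroup Γ} {A : κ → Set X}
    (hA : ∀ k, pure (A k) ≤ almostInvariant μ H) : pure (⋃ k, A k) ≤ almostInvariant μ H := by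
  have h : Tendsto (fun _ : Unit => ⋂ k, (A k)ᶜ) (pure ()) (almostInvariant μ H) :=
    .almostInvariant_iInter fun k => by
      simpa [Tendsto] using pure_compl_le_almostInvariant (hA k)
  simpa [Tendsto] using h.almostInvariant_compl

theorem le_measure_of_pure_le_almostInvariant {H : Subgroup Γ} {δ : ℝ≥0∞}
    (h : Tendsto μ (almostInvariant μ H ⊓ 𝓟 {E | μ E < δ}) (𝓝 0)) {A : Set X}
    (hA : pure A ≤ almostInvariant μ H) (hpos : μ A ≠ 0) : δ ≤ μ A := by
  by_contra! hlt
  exact hpos (tendsto_nhds_unique (tendsto_pure_nhds μ A)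
    (h.mono_left (le_inf hA (by simpa using hlt))))

/-- A finite disjoint family of sets from a class of sets of measure bounded below which cannot be
enlarged by splitting off a further member. -/
theorem exists_pairwise_disjoint_not_splittable [IsProbabilityMeasure μ] {δ : ℝ≥0∞} (hδ : 0 < δ)
    {P : Set X → Prop} (hP : ∀ A, P A → MeasurableSet A ∧ δ ≤ μ A) :
    ∃ (k : ℕ) (Y : Fin k → Set X), (∀ i, P (Y i)) ∧ (Pairwise fun i j => Disjoint (Y i) (Y j)) ∧
      ∀ B, P B → ¬ ∀ i, P (Y i \ B) := by
  by_contra! hcon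
  have hall (k : ℕ) : ∃ Y : Fin k → Set X, (∀ i, P (Y i)) ∧
      Pairwise fun i j => Disjoint (Y i) (Y j) := by
    induction k with
    | zero => exact ⟨fun _ => ∅, fun i => i.elim0, fun i => i.elim0⟩
    | succ k ih =>
      obtain ⟨Y, hY, hd⟩ := ih
      obtain ⟨B, hB, hYB⟩ := hcon k Y hY hd
      refine ⟨Fin.cons B fun i => Y i \ B, Fin.cases hB hYB, fun i j => ?_⟩
      refine Fin.cases ?_ (fun i => ?_) i <;> refine Fin.cases ?_ (fun j => ?_) j <;> intro hij
      · exact absurd rfl hij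
      · exact Set.disjoint_sdiff_right
      · exact Set.disjoint_sdiff_left
      · exact (hd fun h => hij (congrArg Fin.succ h)).mono Set.sdiff_subset Set.sdiff_subset
  obtain ⟨N, hN⟩ := ENNReal.exists_nat_mul_gt hδ.ne' ENNReal.one_ne_top
  obtain ⟨Y, hY, hd⟩ := hall N
  refine hN.not_ge ?_
  calc (N : ℝ≥0∞) * δ = ∑ _i : Fin N, δ := by simp
    _ ≤ ∑ i, μ (Y i) := Finset.sum_le_sum fun i _ => (hP _ (hY i)).2
    _ ≤ μ Set.univ := sum_measure_le_measure_univ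
        (fun i _ => (hP _ (hY i)).1.nullMeasurableSet) fun i _ j _ hij => (hd hij).aedisjoint
    _ = 1 := measure_univ

/-- An ergodic piece of the restricted action is strongly ergodic, provided that the measures of
almost invariant sets have a gap at zero. -/
theorem tendsto_measure_mul_one_sub_of_ergodic [IsProbabilityMeasure μ]
    (hns : ∀ s : Γ, Measure.QuasiMeasurePreserving (fun x : X => s • x) μ μ)
    {H : Subgroup Γ} {δ : ℝ≥0∞} (hδ : 0 < δ)
    (h : Tendsto μ (almostInvariant μ H ⊓ 𝓟 {E | μ E < δ}) (𝓝 0))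
    {Y : Set X} (hY : pure Y ≤ almostInvariant μ H) (hpos : μ Y ≠ 0)
    (herg : ∀ E ⊆ Y, pure E ≤ almostInvariant μ H → μ E = 0 ∨ μ E = μ Y)
    {E : ℕ → Set X} (hE : ∀ n, MeasurableSet (E n)) (hEY : ∀ n, E n ⊆ Y)
    (hinv : ∀ s : H, Tendsto
      (fun n => ((μ Y)⁻¹ • μ.restrict Y) (((s : Γ) • E n) ∆ (E n))) atTop (𝓝 0)) :
    Tendsto (fun n => ((μ Y)⁻¹ • μ.restrict Y) (E n) *
      (1 - ((μ Y)⁻¹ • μ.restrict Y) (E n))) atTop (𝓝 0) := by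
  obtain ⟨hYm, hYinv⟩ := pure_le_almostInvariant_iff.1 hY
  have hcond (A : Set X) : ((μ Y)⁻¹ • μ.restrict Y) A = (μ Y)⁻¹ * μ (A ∩ Y) := by
    rw [Measure.smul_apply, Measure.restrict_apply' hYm, smul_eq_mul]
  have hEtendsto : Tendsto E atTop (almostInvariant μ H) := by
    refine tendsto_almostInvariant_iff.2 ⟨.of_forall hE, fun s => ?_⟩
    have hlim := ENNReal.Tendsto.const_mul (hinv s) (.inr (measure_ne_top μ Y))
    rw [mul_zero] at hlim
    refine tendsto_of_tendsto_of_tendsto_of_le_of_le tendsto_const_nhds hlim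
      (fun _ => zero_le) fun n => ?_
    simp only [hcond, ← mul_assoc, ENNReal.mul_inv_cancel hpos (measure_ne_top μ Y), one_mul]
    have hsub : ((s : Γ) • E n) ∆ E n ⊆
        (((s : Γ) • E n) ∆ E n ∩ Y) ∪ (((s : Γ) • Y) ∆ Y) := by
      intro x hx
      by_cases hxY : x ∈ Y
      · exact .inl ⟨hx, hxY⟩
      · rcases hx with ⟨h1, -⟩ | ⟨h1, -⟩
        · exact .inr (.inl ⟨Set.smul_set_mono (hEY n) h1, hxY⟩)
        · exact absurd (hEY n h1) hxY
    refine (measure_mono hsub).trans ((measure_union_le _ _).trans ?_)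
    rw [hYinv s, add_zero]
  rw [tendsto_iff_ultrafilter]
  intro g hg
  obtain ⟨A, hAm, hA⟩ := exists_tendsto_ultrafilter_almostInvariant (𝒰 := g.map E) hδ h
    (hEtendsto.mono_left hg)
  have hApure : pure (A ∩ Y) ≤ almostInvariant μ H :=
    pure_inter_le_almostInvariant (pure_le_almostInvariant_iff.2 ⟨hAm, fun s =>
      measure_smul_symmDiff_eq_zero_of_tendsto hns (hEtendsto.mono_left hg : ↑(g.map E) ≤ _) hA s⟩)
      hY
  have hd : Tendsto (fun n => (μ Y)⁻¹ * μ (E n ∆ A)) g (𝓝 0) := by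
    simpa using ENNReal.Tendsto.const_mul (tendsto_map'_iff.1 hA)
      (.inr (ENNReal.inv_ne_top.2 hpos))
  refine tendsto_of_tendsto_of_tendsto_of_le_of_le tendsto_const_nhds hd
    (fun _ => zero_le) fun n => ?_
  simp only [hcond, Set.inter_eq_left.2 (hEY n)]
  have hle : (μ Y)⁻¹ * μ (E n) ≤ 1 := by
    rw [← ENNReal.inv_mul_cancel hpos (measure_ne_top μ Y)]
    gcongr
    exact hEY n
  rcases herg _ Set.inter_subset_right hApure with h0 | h1
  · refine (mul_le_of_le_one_right' tsub_le_self).trans ?_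
    refine mul_le_mul' le_rfl ?_
    calc μ (E n) ≤ μ (E n ∆ A ∪ A ∩ Y) := by
          refine measure_mono fun x hx => ?_
          by_cases hxA : x ∈ A
          exacts [.inr ⟨hxA, hEY n hx⟩, .inl (.inl ⟨hx, hxA⟩)]
      _ ≤ μ (E n ∆ A) + μ (A ∩ Y) := measure_union_le _ _
      _ = μ (E n ∆ A) := by rw [h0, add_zero]
  · refine (mul_le_of_le_one_left' hle).trans (tsub_le_iff_right.2 ?_)
    rw [← mul_add, ← ENNReal.inv_mul_cancel hpos (measure_ne_top μ Y)]
    gcongr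
    calc μ Y = μ (A ∩ Y) := h1.symm
      _ ≤ μ (E n ∆ A ∪ E n) := by
          refine measure_mono fun x hx => ?_
          by_cases hxE : x ∈ E n
          exacts [.inr hxE, .inl (.inr ⟨hx.1, hxE⟩)]
      _ ≤ μ (E n ∆ A) + μ (E n) := measure_union_le _ _

end Decomposition

/-- If a countable group `Γ` acts non-singularly and strongly ergodically on a
standard probability space `(X,μ)` and `Λ ≤ Γ` has finite index, then the restricted action
of `Λ` decomposes into finitely many ergodic components, each of which is strongly ergodic. -/
theorem finite_index_restriction_decomposes_into_strongly_ergodic_components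
    {Γ X : Type*} [Group Γ] [Countable Γ]
    [MeasurableSpace X] [StandardBorelSpace X]
    (μ : Measure X) [IsProbabilityMeasure μ]
    [MulAction Γ X]
    (hns : ∀ s : Γ, Measure.QuasiMeasurePreserving (fun x : X => s • x) μ μ)
    (hse : ∀ E : ℕ → Set X, (∀ n, MeasurableSet (E n)) →
      (∀ s : Γ, Tendsto (fun n => μ ((s • E n) ∆ (E n))) atTop (𝓝 0)) →
      Tendsto (fun n => μ (E n) * (1 - μ (E n))) atTop (𝓝 0))
    (Λ : Subgroup Γ) [Λ.FiniteIndex] :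
    ∃ (k : ℕ) (Y : Fin k → Set X),
      (∀ i, MeasurableSet (Y i)) ∧
      (Pairwise fun i j => Disjoint (Y i) (Y j)) ∧
      μ (⋃ i, Y i) = 1 ∧
      (∀ i, 0 < μ (Y i)) ∧
      -- each piece is (a.e.) `Λ`-invariant
      (∀ i, ∀ s : Λ, μ (((s : Γ) • Y i) ∆ (Y i)) = 0) ∧
      -- ergodicity of each component (w.r.t. the normalized restricted measure)
      (∀ i, ∀ E : Set X, MeasurableSet E → E ⊆ Y i →
        (∀ s : Λ, μ (((s : Γ) • E) ∆ E) = 0) → μ E = 0 ∨ μ E = μ (Y i)) ∧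
      -- strong ergodicity of each component (w.r.t. the normalized restricted measure)
      (∀ i, ∀ E : ℕ → Set X, (∀ n, MeasurableSet (E n)) → (∀ n, E n ⊆ Y i) →
        (∀ s : Λ, Tendsto
          (fun n => ((μ (Y i))⁻¹ • μ.restrict (Y i)) (((s : Γ) • E n) ∆ (E n))) atTop (𝓝 0)) →
        Tendsto (fun n => ((μ (Y i))⁻¹ • μ.restrict (Y i)) (E n) *
          (1 - ((μ (Y i))⁻¹ • μ.restrict (Y i)) (E n))) atTop (𝓝 0)) := by
  obtain ⟨δ, hδ, hgap⟩ := exists_tendsto_measure_almostInvariant_inf_principal hns hse Λ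
  obtain ⟨k, Y, hY, hdisj, hsplit⟩ := exists_pairwise_disjoint_not_splittable (μ := μ) hδ
    (P := fun A => pure A ≤ almostInvariant μ Λ ∧ μ A ≠ 0) fun A hA =>
      ⟨(pure_le_almostInvariant_iff.1 hA.1).1, le_measure_of_pure_le_almostInvariant hgap hA.1 hA.2⟩
  have hYinv i := pure_le_almostInvariant_iff.1 (hY i).1
  have herg (i) (E : Set X) (hEY : E ⊆ Y i) (hE : pure E ≤ almostInvariant μ Λ) :
      μ E = 0 ∨ μ E = μ (Y i) := by
    by_contra! hne
    refine hsplit (Y i \ E) ⟨pure_sdiff_le_almostInvariant (hY i).1 hE, fun h0 => hne.2 ?_⟩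
      fun j => ?_
    · exact measure_eq_measure_of_null_sdiff hEY h0
    · by_cases hij : j = i
      · subst hij
        rw [Set.sdiff_sdiff_cancel_left hEY]
        exact ⟨hE, hne.1⟩
      · rw [((hdisj hij).mono_right Set.sdiff_subset).sdiff_eq_left]
        exact hY j
  refine ⟨k, Y, fun i => (hYinv i).1, hdisj, ?_, fun i => pos_iff_ne_zero.2 (hY i).2,
    fun i => (hYinv i).2, fun i E hE hEY hs => herg i E hEY (pure_le_almostInvariant_iff.2 ⟨hE, hs⟩),
    fun i E hE hEY hs => tendsto_measure_mul_one_sub_of_ergodic hns hδ hgap (hY i).1 (hY i).2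
      (herg i) hE hEY hs⟩
  have hU := pure_iUnion_le_almostInvariant fun i => (hY i).1
  by_contra hne
  refine hsplit (⋃ i, Y i)ᶜ ⟨pure_compl_le_almostInvariant hU, fun h0 => hne ?_⟩ fun j => ?_
  · exact (prob_compl_eq_zero_iff (pure_le_almostInvariant_iff.1 hU).1).1 h0
  · rw [Set.sdiff_compl, Set.inter_eq_left.2 (Set.subset_iUnion Y j)]
    exact hY j
end

section
/- Let F be a field and let g ∈ SL(2,F) with g ≠ I and g ≠ −I. Then the centralizer C_{SL(2,F)}(g) = { s ∈ SL(2,F) : sg = gs } is a commutative group. -/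
/-- Two `2 × 2` matrices commute iff the vectors formed by their off-diagonal entries and the
difference of their diagonal entries have vanishing cross product. -/
theorem Matrix.commute_fin_two_iff {R : Type*} [CommRing R] (A B : Matrix (Fin 2) (Fin 2) R) :
    Commute A B ↔ A 0 1 * B 1 0 = B 0 1 * A 1 0 ∧
      A 0 1 * (B 0 0 - B 1 1) = B 0 1 * (A 0 0 - A 1 1) ∧
      A 1 0 * (B 0 0 - B 1 1) = B 1 0 * (A 0 0 - A 1 1) := by
  simp only [commute_iff_eq, ← Matrix.ext_iff, Fin.forall_fin_two, Matrix.mul_apply,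
    Fin.sum_univ_two]
  constructor
  · rintro ⟨⟨h00, h01⟩, h10, -⟩
    exact ⟨by linear_combination h00, by linear_combination -h01, by linear_combination h10⟩
  · rintro ⟨h, h01, h10⟩
    exact ⟨⟨by linear_combination h, by linear_combination -h01⟩,
      by linear_combination h10, by linear_combination -h⟩

/-- Over a domain, matrices commuting with a non-scalar `2 × 2` matrix commute with each other. -/
theorem Matrix.commute_of_commute_of_not_scalar {R : Type*} [CommRing R] [IsDomain R]
    {A B C : Matrix (Fin 2) (Fin 2) R} (hA : ¬(A 0 1 = 0 ∧ A 1 0 = 0 ∧ A 0 0 = A 1 1))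
    (hB : Commute A B) (hC : Commute A C) : Commute B C := by
  rw [Matrix.commute_fin_two_iff] at hB hC ⊢
  obtain ⟨b₁, b₂, b₃⟩ := hB
  obtain ⟨c₁, c₂, c₃⟩ := hC
  by_cases h01 : A 0 1 = 0
  · by_cases h10 : A 1 0 = 0
    · have h : A 0 0 - A 1 1 ≠ 0 := fun h ↦ hA ⟨h01, h10, sub_eq_zero.mp h⟩
      refine ⟨mul_left_cancel₀ h ?_, mul_left_cancel₀ h ?_, mul_left_cancel₀ h ?_⟩ <;> grind
    · refine ⟨mul_left_cancel₀ h10 ?_, mul_left_cancel₀ h10 ?_, mul_left_cancel₀ h10 ?_⟩ <;> grind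
  · refine ⟨mul_left_cancel₀ h01 ?_, mul_left_cancel₀ h01 ?_, mul_left_cancel₀ h01 ?_⟩ <;> grind

/-- For a field `F` and `g ∈ SL(2,F)` with `g ≠ I` and `g ≠ -I`,
the centralizer of `g` in `SL(2,F)` is commutative. -/
theorem centralizer_commutative_SL2 (F : Type*) [Field F]
    (g : Matrix.SpecialLinearGroup (Fin 2) F)
    (h1 : (g : Matrix (Fin 2) (Fin 2) F) ≠ 1)
    (h2 : (g : Matrix (Fin 2) (Fin 2) F) ≠ -1) :
    ∀ s ∈ Subgroup.centralizer {g}, ∀ t ∈ Subgroup.centralizer {g}, s * t = t * s := by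
  have hg : ¬((g : Matrix (Fin 2) (Fin 2) F) 0 1 = 0 ∧ (g : Matrix (Fin 2) (Fin 2) F) 1 0 = 0 ∧
      (g : Matrix (Fin 2) (Fin 2) F) 0 0 = (g : Matrix (Fin 2) (Fin 2) F) 1 1) := by
    rintro ⟨h01, h10, h00⟩
    have hdet := g.det_coe
    rw [Matrix.det_fin_two, h01, h00, zero_mul, sub_zero, mul_self_eq_one_iff] at hdet
    rcases hdet with h | h
    · exact h1 (by ext i j; fin_cases i <;> fin_cases j <;> simp [h01, h10, h00, h])
    · exact h2 (by ext i j; fin_cases i <;> fin_cases j <;> simp [h01, h10, h00, h])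
  have commute_coe : ∀ s ∈ Subgroup.centralizer {g},
      Commute (g : Matrix (Fin 2) (Fin 2) F) (s : Matrix (Fin 2) (Fin 2) F) := fun s hs ↦
    congrArg Subtype.val (Subgroup.mem_centralizer_singleton_iff.mp hs).symm
  intro s hs t ht
  exact Subtype.ext (Matrix.commute_of_commute_of_not_scalar hg (commute_coe s hs)
    (commute_coe t ht))
end

section
/- Let Γ be a countable group with a non-singular action on a standard probability space (X,μ), let C be a non-empty family of subgroups of Γ, and let K = ⊔_{Λ∈C} Γ/Λ with the Γ-action by left translation. (a) If there exists a Γ-invariant state (invariant mean) on ℓ∞(K), then the action Γ ↷ (X,μ) is amenable relative to C, i.e., there exists a Γ-equivariant conditional expectation from L∞(K × X) onto L∞(X). (b) Conversely, if the action is amenable relative to C and there exists a Γ-invariant state on L∞(X) (for example, if μ is Γ-invariant), then there exists a Γ-invariant state on ℓ∞(K). -/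
open MeasureTheory Filter Topology Pointwise
open scoped symmDiff ENNReal

/-- The `Γ`-set `K = ⊔_{Λ ∈ C} Γ/Λ` attached to a family `C` of subgroups of `Γ`. -/
abbrev relAmenKSpace (Γ : Type*) [Group Γ] (C : Set (Subgroup Γ)) : Type _ :=
  Σ Λ : C, Γ ⧸ (Λ : Subgroup Γ)

/-- Every continuous linear functional on `L¹` of a finite measure is represented by an
element of `L∞`. -/
theorem exists_Linfty_integral_eq {X : Type*} [MeasurableSpace X] (μ : Measure X)
    [IsFiniteMeasure μ] (L : Lp ℝ 1 μ →L[ℝ] ℝ) :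
    ∃ h : Lp ℝ ⊤ μ, ∀ g : Lp ℝ 1 μ, L g = ∫ x, h x * g x ∂μ := by
  have hmem : ∀ g : Lp ℝ 2 μ, MemLp g 1 μ := fun g ↦ (Lp.memLp g).mono_exponent (by norm_num)
  let J : Lp ℝ 2 μ →ₗ[ℝ] Lp ℝ 1 μ :=
    { toFun := fun g ↦ (hmem g).toLp g
      map_add' := fun f g ↦ by
        rw [← MemLp.toLp_add]
        exact MemLp.toLp_congr _ _ (Lp.coeFn_add f g)
      map_smul' := fun c g ↦ by
        rw [RingHom.id_apply, ← MemLp.toLp_const_smul]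
        exact MemLp.toLp_congr _ _ (Lp.coeFn_smul c g) }
  obtain ⟨D, hD⟩ : ∃ D, ∀ g, ‖J g‖ ≤ D * ‖g‖ := by
    refine ⟨(μ Set.univ ^ (1 / (1 : ℝ≥0∞).toReal - 1 / (2 : ℝ≥0∞).toReal)).toReal,
      fun g ↦ ?_⟩
    change ‖(hmem g).toLp g‖ ≤ _
    rw [Lp.norm_toLp, Lp.norm_def, ← ENNReal.toReal_mul, mul_comm]
    refine ENNReal.toReal_mono (ENNReal.mul_ne_top (Lp.eLpNorm_ne_top g)
      (ENNReal.rpow_ne_top_of_nonneg (by norm_num) (measure_ne_top _ _))) ?_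
    exact eLpNorm_le_eLpNorm_mul_rpow_measure_univ (by norm_num) (Lp.aestronglyMeasurable g)
  let h := (InnerProductSpace.toDual ℝ (Lp ℝ 2 μ)).symm (L.comp (J.mkContinuous D hD))
  have hh : ∀ g : Lp ℝ 2 μ, inner ℝ h g = L (J g) := fun g ↦ by
    simp only [h, InnerProductSpace.toDual_symm_apply]; rfl
  have hhi : Integrable h μ := memLp_one_iff_integrable.1 (hmem h)
  have hind : ∀ s (hs : MeasurableSet s),
      L (indicatorConstLp 1 hs (measure_ne_top μ s) 1) = ∫ x in s, h x ∂μ := by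
    intro s hs
    have h1 : J (indicatorConstLp 2 hs (measure_ne_top μ s) 1) =
        indicatorConstLp 1 hs (measure_ne_top μ s) 1 :=
      MemLp.toLp_congr (hmem _) (memLp_indicator_const 1 hs 1 (Or.inr (measure_ne_top μ s)))
        indicatorConstLp_coeFn
    rw [← h1, ← hh, real_inner_comm, L2.inner_indicatorConstLp_one hs]
  have hbd : ∀ s (hs : MeasurableSet s), |∫ x in s, h x ∂μ| ≤ ‖L‖ * μ.real s := fun s hs ↦ by
    rw [← hind s hs, ← Real.norm_eq_abs]
    refine (L.le_opNorm _).trans_eq ?_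
    rw [norm_indicatorConstLp one_ne_zero (by simp)]
    simp
  have hle : ∀ᵐ x ∂μ, ‖h x‖ ≤ ‖L‖ := by
    have h1 : h ≤ᵐ[μ] fun _ ↦ ‖L‖ := by
      refine ae_le_of_forall_setIntegral_le hhi (integrable_const _) fun s hs _ ↦ ?_
      rw [setIntegral_const, smul_eq_mul, mul_comm]
      exact (abs_le.1 (hbd s hs)).2
    have h2 : (fun _ ↦ -‖L‖) ≤ᵐ[μ] h := by
      refine ae_le_of_forall_setIntegral_le (integrable_const _) hhi fun s hs _ ↦ ?_
      rw [setIntegral_const, smul_eq_mul, mul_comm, neg_mul]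
      exact (abs_le.1 (hbd s hs)).1
    filter_upwards [h1, h2] with x hx hx'
    exact abs_le.2 ⟨hx', hx⟩
  have hH : MemLp h ⊤ μ := memLp_top_of_bound (Lp.aestronglyMeasurable h) _ hle
  refine ⟨hH.toLp h, fun g ↦ ?_⟩
  let P := ContinuousLinearMap.lpPairing (p := ⊤) (q := 1) μ
    (ContinuousLinearMap.mul ℝ ℝ) (hH.toLp h)
  have hP : ∀ g, P g = ∫ x, (hH.toLp h) x * g x ∂μ := fun g ↦ by
    simp only [P, ContinuousLinearMap.lpPairing_eq_integral, ContinuousLinearMap.mul_apply']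
  rw [← hP]
  refine Lp.induction (by simp) (fun g ↦ L g = P g) (fun c s hs hμs ↦ ?_) ?_
    (isClosed_eq L.continuous P.continuous) g
  · have h1 : ((Lp.simpleFunc.indicatorConst 1 hs hμs.ne c : Lp.simpleFunc ℝ 1 μ) : Lp ℝ 1 μ) =
        c • indicatorConstLp 1 hs (measure_ne_top μ s) 1 := by
      rw [Lp.simpleFunc.coe_indicatorConst]
      ext1
      filter_upwards [indicatorConstLp_coeFn (p := 1) (hs := hs) (hμs := hμs.ne) (c := c),
        Lp.coeFn_smul c (indicatorConstLp 1 hs (measure_ne_top μ s) (1 : ℝ)),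
        indicatorConstLp_coeFn (p := 1) (hs := hs) (hμs := hμs.ne) (c := (1 : ℝ))] with x h1 h2 h3
      rw [h1, h2, Pi.smul_apply, h3]
      by_cases hx : x ∈ s <;> simp [hx]
    rw [h1, map_smul, map_smul, hind, hP, ← integral_indicator hs]
    congr 1
    refine integral_congr_ae ?_
    filter_upwards [hH.coeFn_toLp,
      indicatorConstLp_coeFn (p := 1) (hs := hs) (hμs := hμs.ne) (c := (1 : ℝ))] with x h1 h2
    rw [h1, h2]
    by_cases hx : x ∈ s <;> simp [hx]
  · intro f g hf hg _ h1 h2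
    rw [map_add, map_add, h1, h2]

theorem Linfty_eq_of_integral_mul_eq {X : Type*} [MeasurableSpace X] {μ : Measure X}
    [IsFiniteMeasure μ] {f h : Lp ℝ ⊤ μ}
    (H : ∀ g : Lp ℝ 1 μ, ∫ x, f x * g x ∂μ = ∫ x, h x * g x ∂μ) : f = h := by
  have hint : ∀ f : Lp ℝ ⊤ μ, Integrable f μ := fun f ↦
    memLp_one_iff_integrable.1 ((Lp.memLp f).mono_exponent le_top)
  ext1
  refine Integrable.ae_eq_of_forall_setIntegral_eq _ _ (hint f) (hint h) fun s hs _ ↦ ?_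
  have key : ∀ f : Lp ℝ ⊤ μ, ∫ x in s, f x ∂μ =
      ∫ x, f x * indicatorConstLp 1 hs (measure_ne_top μ s) (1 : ℝ) x ∂μ := fun f ↦ by
    rw [← integral_indicator hs]
    refine integral_congr_ae ?_
    filter_upwards [indicatorConstLp_coeFn (p := 1) (hs := hs) (hμs := measure_ne_top μ s)
      (c := (1 : ℝ))] with x h2
    rw [h2]
    by_cases hx : x ∈ s <;> simp [hx]
  rw [key, key, H]

theorem ae_norm_le_norm_Linfty {X : Type*} [MeasurableSpace X] {μ : Measure X} (f : Lp ℝ ⊤ μ) :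
    ∀ᵐ x ∂μ, ‖f x‖ ≤ ‖f‖ := by
  rw [Lp.norm_def, eLpNorm_exponent_top]
  have hfin : eLpNormEssSup f μ ≠ ⊤ := by
    rw [← eLpNorm_exponent_top]; exact Lp.eLpNorm_ne_top f
  filter_upwards [ae_le_eLpNormEssSup (f := f) (μ := μ)] with x hx
  rw [← toReal_enorm]
  exact ENNReal.toReal_mono hfin hx

theorem forall_of_ae_count {K : Type*} [MeasurableSpace K] [MeasurableSingletonClass K]
    {p : K → Prop} (h : ∀ᵐ k ∂(Measure.count : Measure K), p k) (k : K) : p k := by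
  by_contra hk
  have h0 : (Measure.count : Measure K) {k} = 0 :=
    measure_mono_null (Set.singleton_subset_iff.2 hk) (ae_iff.1 h)
  simp at h0

theorem forall_ae_of_ae_count_prod {K X : Type*} [MeasurableSpace K] [MeasurableSingletonClass K]
    [MeasurableSpace X] {μ : Measure X} [SFinite μ] {p : K × X → Prop}
    (h : ∀ᵐ q ∂(Measure.count : Measure K).prod μ, p q) (k : K) : ∀ᵐ x ∂μ, p (k, x) :=
  forall_of_ae_count (Measure.ae_ae_of_ae_prod h) k

theorem memLp_top_count_of_bound {K : Type*} [MeasurableSpace K] [DiscreteMeasurableSpace K]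
    {f : K → ℝ} (C : ℝ) (hf : ∀ k, ‖f k‖ ≤ C) : MemLp f ⊤ (Measure.count : Measure K) :=
  memLp_top_of_bound (Measurable.of_discrete).aestronglyMeasurable C (ae_of_all _ hf)

/-- A positive unital functional on `ℓ∞(K)` is bounded by the supremum. -/
theorem abs_le_of_forall_norm_le {K : Type*} [MeasurableSpace K] [DiscreteMeasurableSpace K]
    {m : Lp ℝ ⊤ (Measure.count : Measure K) →ₗ[ℝ] ℝ} (hpos : ∀ F, 0 ≤ F → 0 ≤ m F)
    (hone : ∀ F : Lp ℝ ⊤ (Measure.count : Measure K),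
      (F =ᵐ[Measure.count] fun _ ↦ (1 : ℝ)) → m F = 1)
    (F : Lp ℝ ⊤ (Measure.count : Measure K)) {C : ℝ} (hF : ∀ k, |F k| ≤ C) : |m F| ≤ C := by
  have h1 : MemLp (fun _ : K ↦ (1 : ℝ)) ⊤ Measure.count :=
    memLp_top_count_of_bound 1 fun _ ↦ by simp
  have hm1 : m h1.toLp = 1 := hone _ h1.coeFn_toLp
  have hsub : m (C • h1.toLp - F) = C - m F := by simp [hm1]
  have hadd : m (C • h1.toLp + F) = C + m F := by simp [hm1]
  rw [abs_le]
  constructor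
  · have : 0 ≤ m (C • h1.toLp + F) := by
      refine hpos _ (Lp.coeFn_nonneg _ |>.1 ?_)
      filter_upwards [Lp.coeFn_add (C • h1.toLp) F, Lp.coeFn_smul C h1.toLp, h1.coeFn_toLp]
        with k h2 h3 h4
      rw [h2, Pi.add_apply, h3, Pi.smul_apply, h4]
      simpa using neg_le_iff_add_nonneg'.1 (abs_le.1 (hF k)).1
    linarith
  · have : 0 ≤ m (C • h1.toLp - F) := by
      refine hpos _ (Lp.coeFn_nonneg _ |>.1 ?_)
      filter_upwards [Lp.coeFn_sub (C • h1.toLp) F, Lp.coeFn_smul C h1.toLp, h1.coeFn_toLp]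
        with k h2 h3 h4
      rw [h2, Pi.sub_apply, h3, Pi.smul_apply, h4]
      simpa using (abs_le.1 (hF k)).2
    linarith

section SectionPairing

variable {K X : Type*} [MeasurableSpace K] [DiscreteMeasurableSpace K] [MeasurableSpace X]
  {μ : Measure X} [IsProbabilityMeasure μ]

theorem ae_norm_section_le (F : Lp ℝ ⊤ ((Measure.count : Measure K).prod μ)) (k : K) :
    ∀ᵐ x ∂μ, ‖F (k, x)‖ ≤ ‖F‖ :=
  forall_ae_of_ae_count_prod (ae_norm_le_norm_Linfty F) k

omit [DiscreteMeasurableSpace K] [IsProbabilityMeasure μ] in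
theorem aestronglyMeasurable_section (F : Lp ℝ ⊤ ((Measure.count : Measure K).prod μ)) (k : K) :
    AEStronglyMeasurable (fun x ↦ F (k, x)) μ :=
  ((Lp.stronglyMeasurable F).comp_measurable measurable_prodMk_left).aestronglyMeasurable

theorem integrable_section_mul (F : Lp ℝ ⊤ ((Measure.count : Measure K).prod μ)) (k : K)
    {g : X → ℝ} (hg : Integrable g μ) : Integrable (fun x ↦ F (k, x) * g x) μ :=
  hg.bdd_mul (aestronglyMeasurable_section F k) (ae_norm_section_le F k)

theorem norm_integral_section_mul_le (F : Lp ℝ ⊤ ((Measure.count : Measure K).prod μ))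
    (g : Lp ℝ 1 μ) (k : K) : ‖∫ x, F (k, x) * g x ∂μ‖ ≤ ‖F‖ * ‖g‖ := by
  have hg := L1.integrable_coeFn g
  rw [L1.norm_eq_integral_norm, ← integral_const_mul]
  refine norm_integral_le_of_norm_le (hg.norm.const_mul _) ?_
  filter_upwards [ae_norm_section_le F k] with x hx
  rw [norm_mul]
  gcongr

theorem memLp_sectionPairing (F : Lp ℝ ⊤ ((Measure.count : Measure K).prod μ)) (g : Lp ℝ 1 μ) :
    MemLp (fun k ↦ ∫ x, F (k, x) * g x ∂μ) ⊤ (Measure.count : Measure K) :=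
  memLp_top_count_of_bound _ (norm_integral_section_mul_le F g)

/-- The element `k ↦ ∫ F(k, x) g(x) dμ(x)` of `ℓ∞(K)`. -/
noncomputable def sectionPairing (F : Lp ℝ ⊤ ((Measure.count : Measure K).prod μ))
    (g : Lp ℝ 1 μ) : Lp ℝ ⊤ (Measure.count : Measure K) :=
  (memLp_sectionPairing F g).toLp _

theorem sectionPairing_apply (F : Lp ℝ ⊤ ((Measure.count : Measure K).prod μ))
    (g : Lp ℝ 1 μ) (k : K) : sectionPairing F g k = ∫ x, F (k, x) * g x ∂μ :=
  forall_of_ae_count (memLp_sectionPairing F g).coeFn_toLp k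

omit [DiscreteMeasurableSpace K] in
theorem ext_count {F G : Lp ℝ ⊤ (Measure.count : Measure K)} (h : ∀ k, F k = G k) : F = G :=
  Lp.ext (ae_of_all _ h)

theorem count_add_apply (F G : Lp ℝ ⊤ (Measure.count : Measure K)) (k : K) :
    (F + G) k = F k + G k :=
  forall_of_ae_count (Lp.coeFn_add F G) k

theorem count_smul_apply (c : ℝ) (F : Lp ℝ ⊤ (Measure.count : Measure K)) (k : K) :
    (c • F) k = c * F k :=
  forall_of_ae_count (Lp.coeFn_smul c F) k

theorem sectionPairing_add_right (F : Lp ℝ ⊤ ((Measure.count : Measure K).prod μ))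
    (g h : Lp ℝ 1 μ) :
    sectionPairing F (g + h) = sectionPairing F g + sectionPairing F h := by
  refine ext_count fun k ↦ ?_
  rw [count_add_apply, sectionPairing_apply, sectionPairing_apply, sectionPairing_apply,
    ← integral_add (integrable_section_mul F k (L1.integrable_coeFn g))
      (integrable_section_mul F k (L1.integrable_coeFn h))]
  refine integral_congr_ae ?_
  filter_upwards [Lp.coeFn_add g h] with x hx
  rw [hx, Pi.add_apply, mul_add]

theorem sectionPairing_smul_right (c : ℝ) (F : Lp ℝ ⊤ ((Measure.count : Measure K).prod μ))
    (g : Lp ℝ 1 μ) : sectionPairing F (c • g) = c • sectionPairing F g := by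
  refine ext_count fun k ↦ ?_
  rw [count_smul_apply, sectionPairing_apply, sectionPairing_apply, ← integral_const_mul]
  refine integral_congr_ae ?_
  filter_upwards [Lp.coeFn_smul c g] with x hx
  rw [hx, Pi.smul_apply, smul_eq_mul]
  ring

theorem sectionPairing_add_left (F G : Lp ℝ ⊤ ((Measure.count : Measure K).prod μ))
    (g : Lp ℝ 1 μ) :
    sectionPairing (F + G) g = sectionPairing F g + sectionPairing G g := by
  refine ext_count fun k ↦ ?_
  rw [count_add_apply, sectionPairing_apply, sectionPairing_apply, sectionPairing_apply,
    ← integral_add (integrable_section_mul F k (L1.integrable_coeFn g))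
      (integrable_section_mul G k (L1.integrable_coeFn g))]
  refine integral_congr_ae ?_
  filter_upwards [forall_ae_of_ae_count_prod (Lp.coeFn_add F G) k] with x hx
  rw [hx, Pi.add_apply, add_mul]

theorem sectionPairing_smul_left (c : ℝ) (F : Lp ℝ ⊤ ((Measure.count : Measure K).prod μ))
    (g : Lp ℝ 1 μ) : sectionPairing (c • F) g = c • sectionPairing F g := by
  refine ext_count fun k ↦ ?_
  rw [count_smul_apply, sectionPairing_apply, sectionPairing_apply, ← integral_const_mul]
  refine integral_congr_ae ?_
  filter_upwards [forall_ae_of_ae_count_prod (Lp.coeFn_smul c F) k] with x hx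
  rw [hx, Pi.smul_apply, smul_eq_mul]
  ring

/-- A state `m` on `ℓ∞(K)` induces a linear map `L∞(K × X) → L∞(X)`, determined by
`∫ Φ(F) g dμ = m (k ↦ ∫ F(k, ·) g dμ)`. -/
theorem exists_linearMap_integral_mul_eq {m : Lp ℝ ⊤ (Measure.count : Measure K) →ₗ[ℝ] ℝ}
    (hpos : ∀ F, 0 ≤ F → 0 ≤ m F)
    (hone : ∀ F : Lp ℝ ⊤ (Measure.count : Measure K),
      (F =ᵐ[Measure.count] fun _ ↦ (1 : ℝ)) → m F = 1) :
    ∃ Φ : Lp ℝ ⊤ ((Measure.count : Measure K).prod μ) →ₗ[ℝ] Lp ℝ ⊤ μ,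
      ∀ F (g : Lp ℝ 1 μ), ∫ x, Φ F x * g x ∂μ = m (sectionPairing F g) := by
  have hex : ∀ F : Lp ℝ ⊤ ((Measure.count : Measure K).prod μ), ∃ h : Lp ℝ ⊤ μ,
      ∀ g : Lp ℝ 1 μ, ∫ x, h x * g x ∂μ = m (sectionPairing F g) := by
    intro F
    let L : Lp ℝ 1 μ →ₗ[ℝ] ℝ :=
      { toFun := fun g ↦ m (sectionPairing F g)
        map_add' := fun g h ↦ by rw [sectionPairing_add_right, map_add]
        map_smul' := fun c g ↦ by rw [sectionPairing_smul_right, map_smul, RingHom.id_apply] }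
    obtain ⟨h, hh⟩ := exists_Linfty_integral_eq μ (L.mkContinuous ‖F‖ fun g ↦
      abs_le_of_forall_norm_le hpos hone _ fun k ↦ by
        rw [sectionPairing_apply]
        exact norm_integral_section_mul_le F g k)
    exact ⟨h, fun g ↦ (hh g).symm⟩
  choose Φ hΦ using hex
  have hint : ∀ (f : Lp ℝ ⊤ μ) (g : Lp ℝ 1 μ), Integrable (fun x ↦ f x * g x) μ := fun f g ↦
    (L1.integrable_coeFn g).bdd_mul (Lp.aestronglyMeasurable f) (ae_norm_le_norm_Linfty f)
  refine ⟨⟨⟨Φ, fun F G ↦ ?_⟩, fun c F ↦ ?_⟩, hΦ⟩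
  · refine Linfty_eq_of_integral_mul_eq fun g ↦ ?_
    rw [hΦ, sectionPairing_add_left, map_add, ← hΦ, ← hΦ, ← integral_add (hint _ g) (hint _ g)]
    refine integral_congr_ae ?_
    filter_upwards [Lp.coeFn_add (Φ F) (Φ G)] with x hx
    rw [hx, Pi.add_apply, add_mul]
  · refine Linfty_eq_of_integral_mul_eq fun g ↦ ?_
    rw [hΦ, sectionPairing_smul_left, map_smul, ← hΦ, smul_eq_mul, ← integral_const_mul]
    refine integral_congr_ae ?_
    filter_upwards [Lp.coeFn_smul c (Φ F)] with x hx
    rw [RingHom.id_apply, hx, Pi.smul_apply, smul_eq_mul, mul_assoc]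

end SectionPairing

theorem exists_L1_change_of_variables {X : Type*} [MeasurableSpace X] {μ : Measure X}
    [IsFiniteMeasure μ] (e : X ≃ᵐ X) (he : Measure.QuasiMeasurePreserving e μ μ)
    (g : Lp ℝ 1 μ) :
    ∃ g' : Lp ℝ 1 μ, ∀ φ : X → ℝ, ∫ x, φ (e x) * g x ∂μ = ∫ x, φ x * g' x ∂μ := by
  have hac : μ.map e ≪ μ := he.absolutelyContinuous
  have hint : Integrable (fun y ↦ ((μ.map e).rnDeriv μ y).toReal • g (e.symm y)) μ := by
    rw [integrable_rnDeriv_smul_iff hac, e.measurableEmbedding.integrable_map_iff]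
    simpa [Function.comp_def] using L1.integrable_coeFn g
  refine ⟨hint.toL1 _, fun φ ↦ ?_⟩
  have h1 : ∫ x, φ (e x) * g x ∂μ = ∫ y, φ y * g (e.symm y) ∂(μ.map e) := by
    rw [e.measurableEmbedding.integral_map]
    simp
  rw [h1, ← integral_rnDeriv_smul hac]
  refine integral_congr_ae ?_
  filter_upwards [hint.coeFn_toL1] with y hy
  rw [hy, smul_eq_mul, smul_eq_mul]
  ring

theorem exists_equivariant_expectation_of_invariant_state {Γ K X : Type*} [Group Γ]
    [MeasurableSpace K] [DiscreteMeasurableSpace K] [MulAction Γ K]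
    [MeasurableSpace X] {μ : Measure X} [IsProbabilityMeasure μ] [MulAction Γ X]
    (hns : ∀ s : Γ, Measure.QuasiMeasurePreserving (fun x : X ↦ s • x) μ μ)
    {m : Lp ℝ ⊤ (Measure.count : Measure K) →ₗ[ℝ] ℝ}
    (hpos : ∀ F, 0 ≤ F → 0 ≤ m F)
    (hone : ∀ F : Lp ℝ ⊤ (Measure.count : Measure K),
      (F =ᵐ[Measure.count] fun _ ↦ (1 : ℝ)) → m F = 1)
    (hinv : ∀ (s : Γ) (F G : Lp ℝ ⊤ (Measure.count : Measure K)),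
      (G =ᵐ[Measure.count] fun k ↦ F (s⁻¹ • k)) → m G = m F) :
    ∃ Φ : Lp ℝ ⊤ ((Measure.count : Measure K).prod μ) →ₗ[ℝ] Lp ℝ ⊤ μ,
      (∀ F, 0 ≤ F → 0 ≤ Φ F) ∧
      (∀ (f : Lp ℝ ⊤ μ) (F : Lp ℝ ⊤ ((Measure.count : Measure K).prod μ)),
        (F =ᵐ[(Measure.count : Measure K).prod μ] fun p ↦ f p.2) → Φ F = f) ∧
      (∀ (s : Γ) (F G : Lp ℝ ⊤ ((Measure.count : Measure K).prod μ)),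
        (G =ᵐ[(Measure.count : Measure K).prod μ] fun p ↦ F (s⁻¹ • p.1, s⁻¹ • p.2)) →
        ∀ u : Lp ℝ ⊤ μ, (u =ᵐ[μ] fun x ↦ Φ F (s⁻¹ • x)) → Φ G = u) := by
  obtain ⟨Φ, hΦ⟩ := exists_linearMap_integral_mul_eq (μ := μ) hpos hone
  refine ⟨Φ, fun F hF ↦ ?_, fun f F hF ↦ ?_, fun s F G hG u hu ↦ ?_⟩
  · refine (Lp.coeFn_nonneg _).1 (ae_nonneg_of_forall_setIntegral_nonneg
      (memLp_one_iff_integrable.1 ((Lp.memLp (Φ F)).mono_exponent le_top)) fun t ht _ ↦ ?_)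
    have hind := indicatorConstLp_coeFn (p := 1) (hs := ht) (hμs := measure_ne_top μ t)
      (c := (1 : ℝ))
    have h1 : ∫ x in t, Φ F x ∂μ =
        ∫ x, Φ F x * indicatorConstLp 1 ht (measure_ne_top μ t) (1 : ℝ) x ∂μ := by
      rw [← integral_indicator ht]
      refine integral_congr_ae ?_
      filter_upwards [hind] with x hx
      rw [hx]
      by_cases hxt : x ∈ t <;> simp [hxt]
    rw [h1, hΦ]
    refine hpos _ ((Lp.coeFn_nonneg _).1 (ae_of_all _ fun k ↦ ?_))
    rw [sectionPairing_apply]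
    refine integral_nonneg_of_ae ?_
    filter_upwards [hind, forall_ae_of_ae_count_prod ((Lp.coeFn_nonneg F).2 hF) k] with x hx hFx
    rw [hx]
    exact mul_nonneg hFx (Set.indicator_nonneg (fun _ _ ↦ zero_le_one) x)
  · refine Linfty_eq_of_integral_mul_eq fun g ↦ ?_
    have h1 : MemLp (fun _ : K ↦ (1 : ℝ)) ⊤ Measure.count :=
      memLp_top_count_of_bound 1 fun _ ↦ by simp
    have h2 : sectionPairing F g = (∫ x, f x * g x ∂μ) • h1.toLp := by
      refine ext_count fun k ↦ ?_
      rw [count_smul_apply, sectionPairing_apply, forall_of_ae_count h1.coeFn_toLp k, mul_one]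
      refine integral_congr_ae ?_
      filter_upwards [forall_ae_of_ae_count_prod hF k] with x hx
      rw [hx]
    rw [hΦ, h2, map_smul, hone _ h1.coeFn_toLp, smul_eq_mul, mul_one]
  · let e : X ≃ᵐ X :=
      { toEquiv := MulAction.toPerm s⁻¹
        measurable_toFun := (hns s⁻¹).measurable
        measurable_invFun := (hns s⁻¹⁻¹).measurable }
    refine Linfty_eq_of_integral_mul_eq fun g ↦ ?_
    obtain ⟨g', hg'⟩ := exists_L1_change_of_variables e (hns s⁻¹) g
    rw [hΦ, hinv s (sectionPairing F g') (sectionPairing G g), ← hΦ, ← hg']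
    · refine integral_congr_ae ?_
      filter_upwards [hu] with x hx
      rw [hx]
      rfl
    · refine ae_of_all _ fun k ↦ ?_
      beta_reduce
      rw [sectionPairing_apply, sectionPairing_apply, ← hg' fun x ↦ F (s⁻¹ • k, x)]
      refine integral_congr_ae ?_
      filter_upwards [forall_ae_of_ae_count_prod hG k] with x hx
      rw [hx]
      rfl

theorem quasiMeasurePreserving_count_prod {K X : Type*} [MeasurableSpace K]
    [DiscreteMeasurableSpace K] [MeasurableSpace X] {μ : Measure X} [SFinite μ]
    (σ : K → K) {τ : X → X} (hτ : Measure.QuasiMeasurePreserving τ μ μ) :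
    Measure.QuasiMeasurePreserving (fun p : K × X ↦ (σ p.1, τ p.2))
      ((Measure.count : Measure K).prod μ) ((Measure.count : Measure K).prod μ) := by
  have hmeas : Measurable fun p : K × X ↦ (σ p.1, τ p.2) :=
    (Measurable.of_discrete.comp measurable_fst).prodMk (hτ.measurable.comp measurable_snd)
  refine ⟨hmeas, Measure.AbsolutelyContinuous.mk fun N hN h0 ↦ ?_⟩
  rw [Measure.map_apply hmeas hN, Measure.measure_prod_null (hmeas hN)]
  refine ae_of_all _ fun k ↦ ?_
  exact hτ.preimage_null (forall_of_ae_count ((Measure.measure_prod_null hN).1 h0) (σ k))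

theorem exists_invariant_state_of_equivariant_expectation {Γ K X : Type*} [Group Γ]
    [MeasurableSpace K] [DiscreteMeasurableSpace K] [MulAction Γ K]
    [MeasurableSpace X] {μ : Measure X} [IsProbabilityMeasure μ] [MulAction Γ X]
    (hns : ∀ s : Γ, Measure.QuasiMeasurePreserving (fun x : X ↦ s • x) μ μ)
    {Φ : Lp ℝ ⊤ ((Measure.count : Measure K).prod μ) →ₗ[ℝ] Lp ℝ ⊤ μ}
    (hpos : ∀ F, 0 ≤ F → 0 ≤ Φ F)
    (hcond : ∀ (f : Lp ℝ ⊤ μ) (F : Lp ℝ ⊤ ((Measure.count : Measure K).prod μ)),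
      (F =ᵐ[(Measure.count : Measure K).prod μ] fun p ↦ f p.2) → Φ F = f)
    (hequiv : ∀ (s : Γ) (F G : Lp ℝ ⊤ ((Measure.count : Measure K).prod μ)),
      (G =ᵐ[(Measure.count : Measure K).prod μ] fun p ↦ F (s⁻¹ • p.1, s⁻¹ • p.2)) →
      ∀ u : Lp ℝ ⊤ μ, (u =ᵐ[μ] fun x ↦ Φ F (s⁻¹ • x)) → Φ G = u)
    {ξ : Lp ℝ ⊤ μ →ₗ[ℝ] ℝ} (hξpos : ∀ f, 0 ≤ f → 0 ≤ ξ f)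
    (hξone : ∀ f : Lp ℝ ⊤ μ, (f =ᵐ[μ] fun _ ↦ (1 : ℝ)) → ξ f = 1)
    (hξinv : ∀ (s : Γ) (f g : Lp ℝ ⊤ μ), (g =ᵐ[μ] fun x ↦ f (s⁻¹ • x)) → ξ g = ξ f) :
    ∃ m : Lp ℝ ⊤ (Measure.count : Measure K) →ₗ[ℝ] ℝ,
      (∀ F, 0 ≤ F → 0 ≤ m F) ∧
      (∀ F : Lp ℝ ⊤ (Measure.count : Measure K),
        (F =ᵐ[Measure.count] fun _ ↦ (1 : ℝ)) → m F = 1) ∧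
      (∀ (s : Γ) (F G : Lp ℝ ⊤ (Measure.count : Measure K)),
        (G =ᵐ[Measure.count] fun k ↦ F (s⁻¹ • k)) → m G = m F) := by
  have hmem : ∀ F : Lp ℝ ⊤ (Measure.count : Measure K),
      MemLp (fun p : K × X ↦ F p.1) ⊤ ((Measure.count : Measure K).prod μ) := fun F ↦
    memLp_top_of_bound (Measurable.of_discrete.comp measurable_fst).aestronglyMeasurable ‖F‖
      (ae_of_all _ fun p ↦ forall_of_ae_count (ae_norm_le_norm_Linfty F) p.1)
  let J : Lp ℝ ⊤ (Measure.count : Measure K) →ₗ[ℝ]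
      Lp ℝ ⊤ ((Measure.count : Measure K).prod μ) :=
    { toFun := fun F ↦ (hmem F).toLp
      map_add' := fun F G ↦ by
        rw [← MemLp.toLp_add]
        exact MemLp.toLp_congr _ _ (ae_of_all _ fun p ↦ count_add_apply F G p.1)
      map_smul' := fun c F ↦ by
        rw [RingHom.id_apply, ← MemLp.toLp_const_smul]
        exact MemLp.toLp_congr _ _ (ae_of_all _ fun p ↦ count_smul_apply c F p.1) }
  have hJ : ∀ F, J F =ᵐ[(Measure.count : Measure K).prod μ] fun p ↦ F p.1 := fun F ↦
    (hmem F).coeFn_toLp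
  refine ⟨ξ ∘ₗ Φ ∘ₗ J, fun F hF ↦ ?_, fun F hF ↦ ?_, fun s F G hG ↦ ?_⟩
  · refine hξpos _ (hpos _ ((Lp.coeFn_nonneg _).1 ?_))
    filter_upwards [hJ F] with p hp
    rw [hp]
    exact forall_of_ae_count ((Lp.coeFn_nonneg F).2 hF) p.1
  · have h1 : MemLp (fun _ : X ↦ (1 : ℝ)) ⊤ μ := memLp_const 1
    have h2 : Φ (J F) = h1.toLp := by
      refine hcond _ _ ?_
      filter_upwards [hJ F, Measure.quasiMeasurePreserving_snd.ae h1.coeFn_toLp] with p hp hp'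
      rw [hp, hp', forall_of_ae_count hF p.1]
    change ξ (Φ (J F)) = 1
    rw [h2, hξone _ h1.coeFn_toLp]
  · have hu : MemLp (fun x ↦ Φ (J F) (s⁻¹ • x)) ⊤ μ :=
      memLp_top_of_bound
        ((Lp.aestronglyMeasurable (Φ (J F))).comp_quasiMeasurePreserving (hns s⁻¹)) ‖Φ (J F)‖
        ((hns s⁻¹).ae (ae_norm_le_norm_Linfty _))
    have h2 : Φ (J G) = hu.toLp := by
      refine hequiv s (J F) (J G) ?_ _ hu.coeFn_toLp
      filter_upwards [hJ G, (quasiMeasurePreserving_count_prod (fun k : K ↦ s⁻¹ • k)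
        (hns s⁻¹)).ae (hJ F)] with p hp hp'
      rw [hp, hp', forall_of_ae_count hG p.1]
    change ξ (Φ (J G)) = ξ (Φ (J F))
    rw [h2]
    exact hξinv s _ _ hu.coeFn_toLp

instance relAmenKSpace.instDiscreteMeasurableSpace {Γ : Type*} [Group Γ] [MeasurableSpace Γ]
    [DiscreteMeasurableSpace Γ] (C : Set (Subgroup Γ)) :
    DiscreteMeasurableSpace (relAmenKSpace Γ C) :=
  ⟨fun t ↦ MeasurableSpace.measurableSet_iInf.2 fun Λ ↦
    MeasurableSpace.map_def.2 (MeasurableSet.of_discrete (s := Sigma.mk Λ ⁻¹' t))⟩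

/-- for a non-singular action `Γ ↷ (X,μ)` of a countable group on a standard
probability space and a non-empty family `C` of subgroups with `K = ⊔_{Λ∈C} Γ/Λ`:
(a) a `Γ`-invariant state on `ℓ∞(K)` yields a `Γ`-equivariant conditional expectation
`L∞(K × X) → L∞(X)` (amenability relative to `C`);
(b) conversely, such a conditional expectation together with a `Γ`-invariant state on `L∞(X)`
yields a `Γ`-invariant state on `ℓ∞(K)`. -/
theorem rel_amenable_iff_invariant_state
    {Γ X : Type*} [Group Γ] [Countable Γ]
    [MeasurableSpace Γ] [MeasurableSingletonClass Γ]
    [MeasurableSpace X] [StandardBorelSpace X]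
    (μ : Measure X) [IsProbabilityMeasure μ]
    [MulAction Γ X]
    (hns : ∀ s : Γ, Measure.QuasiMeasurePreserving (fun x : X => s • x) μ μ)
    (C : Set (Subgroup Γ)) (hC : C.Nonempty) :
    -- (a)
    ((∃ m : Lp ℝ ⊤ (Measure.count : Measure (relAmenKSpace Γ C)) →ₗ[ℝ] ℝ,
        (∀ F, 0 ≤ F → 0 ≤ m F) ∧
        (∀ F : Lp ℝ ⊤ (Measure.count : Measure (relAmenKSpace Γ C)),
          (⇑F =ᵐ[(Measure.count : Measure (relAmenKSpace Γ C))] fun _ => (1 : ℝ)) →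
          m F = 1) ∧
        (∀ (s : Γ) (F G : Lp ℝ ⊤ (Measure.count : Measure (relAmenKSpace Γ C))),
          (⇑G =ᵐ[(Measure.count : Measure (relAmenKSpace Γ C))]
            fun k => F ⟨k.1, s⁻¹ • k.2⟩) → m G = m F)) →
      (∃ Φ : Lp ℝ ⊤ ((Measure.count : Measure (relAmenKSpace Γ C)).prod μ) →ₗ[ℝ] Lp ℝ ⊤ μ,
        (∀ F, 0 ≤ F → 0 ≤ Φ F) ∧
        (∀ (f : Lp ℝ ⊤ μ)
           (F : Lp ℝ ⊤ ((Measure.count : Measure (relAmenKSpace Γ C)).prod μ)),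
           (⇑F =ᵐ[(Measure.count : Measure (relAmenKSpace Γ C)).prod μ] fun p => f p.2) →
           Φ F = f) ∧
        (∀ (s : Γ) (F G : Lp ℝ ⊤ ((Measure.count : Measure (relAmenKSpace Γ C)).prod μ)),
           (⇑G =ᵐ[(Measure.count : Measure (relAmenKSpace Γ C)).prod μ]
              fun p => F (⟨p.1.1, s⁻¹ • p.1.2⟩, s⁻¹ • p.2)) →
           ∀ u : Lp ℝ ⊤ μ, (⇑u =ᵐ[μ] fun x => Φ F (s⁻¹ • x)) → Φ G = u)))
    ∧
    -- (b)
    ((∃ Φ : Lp ℝ ⊤ ((Measure.count : Measure (relAmenKSpace Γ C)).prod μ) →ₗ[ℝ] Lp ℝ ⊤ μ,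
        (∀ F, 0 ≤ F → 0 ≤ Φ F) ∧
        (∀ (f : Lp ℝ ⊤ μ)
           (F : Lp ℝ ⊤ ((Measure.count : Measure (relAmenKSpace Γ C)).prod μ)),
           (⇑F =ᵐ[(Measure.count : Measure (relAmenKSpace Γ C)).prod μ] fun p => f p.2) →
           Φ F = f) ∧
        (∀ (s : Γ) (F G : Lp ℝ ⊤ ((Measure.count : Measure (relAmenKSpace Γ C)).prod μ)),
           (⇑G =ᵐ[(Measure.count : Measure (relAmenKSpace Γ C)).prod μ]
              fun p => F (⟨p.1.1, s⁻¹ • p.1.2⟩, s⁻¹ • p.2)) →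
           ∀ u : Lp ℝ ⊤ μ, (⇑u =ᵐ[μ] fun x => Φ F (s⁻¹ • x)) → Φ G = u)) →
      (∃ ξ : Lp ℝ ⊤ μ →ₗ[ℝ] ℝ,
        (∀ f, 0 ≤ f → 0 ≤ ξ f) ∧
        (∀ f : Lp ℝ ⊤ μ, (⇑f =ᵐ[μ] fun _ => (1 : ℝ)) → ξ f = 1) ∧
        (∀ (s : Γ) (f g : Lp ℝ ⊤ μ), (⇑g =ᵐ[μ] fun x => f (s⁻¹ • x)) → ξ g = ξ f)) →
      (∃ m : Lp ℝ ⊤ (Measure.count : Measure (relAmenKSpace Γ C)) →ₗ[ℝ] ℝ,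
        (∀ F, 0 ≤ F → 0 ≤ m F) ∧
        (∀ F : Lp ℝ ⊤ (Measure.count : Measure (relAmenKSpace Γ C)),
          (⇑F =ᵐ[(Measure.count : Measure (relAmenKSpace Γ C))] fun _ => (1 : ℝ)) →
          m F = 1) ∧
        (∀ (s : Γ) (F G : Lp ℝ ⊤ (Measure.count : Measure (relAmenKSpace Γ C))),
          (⇑G =ᵐ[(Measure.count : Measure (relAmenKSpace Γ C))]
            fun k => F ⟨k.1, s⁻¹ • k.2⟩) → m G = m F))) := by
  constructor
  · rintro ⟨m, hpos, hone, hinv⟩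
    exact exists_equivariant_expectation_of_invariant_state hns hpos hone hinv
  · rintro ⟨Φ, hpos, hcond, hequiv⟩ ⟨ξ, hξpos, hξone, hξinv⟩
    exact exists_invariant_state_of_equivariant_expectation hns hpos hcond hequiv
      hξpos hξone hξinv
end
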